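/- Let P be a frame polyomino and Δ(P) the simplicial complex attached to in_<(I_P). Then Δ(P) is a pure shellable simplicial complex, and the list F_0, F_1, …, F_r of all facets of Δ(P) ordered lexicographically in descending order (F_0 >_lex F_1 >_lex … >_lex F_r) is a shelling order of Δ(P). -/

import Mathlib

noncomputable section

open scoped BigOperators

/-! ## Polyominoes -/

/-- Two cells of `ℤ²` (identified with their lower left corners) share an edge. -/
def cellAdj (c d : ℤ × ℤ) : Prop :=
  (c.1 = d.1 ∧ (d.2 = c.2 + 1 ∨ c.2 = d.2 + 1)) ∨
  (c.2 = d.2 ∧ (d.1 = c.1 + 1 ∨ c.1 = d.1 + 1))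

/-- A polyomino: a nonempty finite collection of cells of `ℤ²` any two of which are
connected by a path of cells of the collection in which consecutive cells share an edge. -/
structure Polyomino : Type where
  cells : Finset (ℤ × ℤ)
  nonempty : cells.Nonempty
  connected : ∀ c ∈ cells, ∀ d ∈ cells,
    Relation.ReflTransGen (fun u v => u ∈ cells ∧ v ∈ cells ∧ cellAdj u v) c d

/-- The four vertices of the cell with lower left corner `c`. -/
def cellVertices (c : ℤ × ℤ) : Finset (ℤ × ℤ) :=
  {c, (c.1 + 1, c.2), (c.1, c.2 + 1), (c.1 + 1, c.2 + 1)}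

/-- The vertex set `V(P)` of a polyomino. -/
def Polyomino.vertexSet (P : Polyomino) : Finset (ℤ × ℤ) :=
  P.cells.biUnion cellVertices

/-- The rank of `P`: the number of its cells. -/
def Polyomino.rank (P : Polyomino) : ℕ := P.cells.card

/-- The cell with lower left corner `c` is contained in the interval `[a, b]` of `ℤ²`. -/
def cellInInterval (a b c : ℤ × ℤ) : Prop :=
  a.1 ≤ c.1 ∧ c.1 + 1 ≤ b.1 ∧ a.2 ≤ c.2 ∧ c.2 + 1 ≤ b.2

/-- `[a, b]` is an inner interval of the polyomino `P`: it is a proper interval all of whose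
cells belong to `P`. -/
def IsInnerInterval (P : Polyomino) (a b : ℤ × ℤ) : Prop :=
  a.1 < b.1 ∧ a.2 < b.2 ∧ ∀ c : ℤ × ℤ, cellInInterval a b c → c ∈ P.cells

/-! ## North-east paths, parallelogram and frame polyominoes -/

/-- A north-east path: consecutive points form east or north steps. -/
def IsNEPath (L : List (ℤ × ℤ)) : Prop :=
  L ≠ [] ∧ L.Chain' (fun u v => v = (u.1 + 1, u.2) ∨ v = (u.1, u.2 + 1))

/-- The path `L` contains the east step from `(x, h)` to `(x + 1, h)`. -/
def eastStepOf (L : List (ℤ × ℤ)) (x h : ℤ) : Prop :=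
  ((x, h), (x + 1, h)) ∈ L.zip L.tail

/-- The cell with lower left corner `c` lies (strictly) below the north-east path `L`. -/
def cellBelowPath (L : List (ℤ × ℤ)) (c : ℤ × ℤ) : Prop :=
  ∃ h, eastStepOf L c.1 h ∧ c.2 < h

/-- The cell with lower left corner `c` lies (weakly) above the north-east path `L`. -/
def cellAbovePath (L : List (ℤ × ℤ)) (c : ℤ × ℤ) : Prop :=
  ∃ h, eastStepOf L c.1 h ∧ h ≤ c.2

/-- The interior points of a path (all points except the two endpoints). -/
def interiorPts (L : List (ℤ × ℤ)) : List (ℤ × ℤ) := (L.drop 1).dropLast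

/-- `S1` lies above `S2`. -/
def LiesAbove (S1 S2 : List (ℤ × ℤ)) : Prop :=
  ∀ p ∈ interiorPts S1, ∀ q ∈ interiorPts S2, p.1 = q.1 → q.2 < p.2

/-- The combinatorial data of a pair of north-east paths with the same endpoints,
the first lying above the second. -/
structure ParallelogramOn (S1 S2 : List (ℤ × ℤ)) : Prop where
  ne1 : IsNEPath S1
  ne2 : IsNEPath S2
  headEq : S1.head? = S2.head?
  lastEq : S1.getLast? = S2.getLast?
  above : LiesAbove S1 S2

/-- The cells of the region bounded above by `S1` and below by `S2`. -/
def parCells (S1 S2 : List (ℤ × ℤ)) : Set (ℤ × ℤ) :=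
  {c | cellBelowPath S1 c ∧ cellAbovePath S2 c}

/-- `P` is a parallelogram polyomino. -/
def IsParallelogram (P : Polyomino) : Prop :=
  ∃ S1 S2 : List (ℤ × ℤ), ParallelogramOn S1 S2 ∧
    (↑P.cells : Set (ℤ × ℤ)) = parCells S1 S2

/-- The data defining a frame polyomino: a rectangle `[(1,1),(m,n)]` and a parallelogram
polyomino determined by `S1, S2` with endpoints `(a0, b0)` and `(ak, bk)`. -/
structure FrameData : Type where
  m : ℤ
  n : ℤ
  S1 : List (ℤ × ℤ)
  S2 : List (ℤ × ℤ)
  a0 : ℤ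
  b0 : ℤ
  ak : ℤ
  bk : ℤ
  par : ParallelogramOn S1 S2
  head1 : S1.head? = some (a0, b0)
  last1 : S1.getLast? = some (ak, bk)
  ha0 : 1 < a0
  hak : a0 < ak
  ham : ak < m
  hb0 : 1 < b0
  hbk : b0 < bk
  hbn : bk < n

/-- The cells of the hole of a frame polyomino. -/
def FrameData.holeCells (D : FrameData) : Set (ℤ × ℤ) := parCells D.S1 D.S2

/-- The cells of the ambient rectangle `[(1,1),(m,n)]`. -/
def FrameData.rectCells (D : FrameData) : Set (ℤ × ℤ) :=
  {c | 1 ≤ c.1 ∧ c.1 + 1 ≤ D.m ∧ 1 ≤ c.2 ∧ c.2 + 1 ≤ D.n}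

/-- `P` is the frame polyomino determined by the data `D`. -/
def IsFrame (P : Polyomino) (D : FrameData) : Prop :=
  (↑P.cells : Set (ℤ × ℤ)) = D.rectCells \ D.holeCells

/-! ## The polyomino ideal -/

/-- The order on the variables: `x_(i,j) > x_(k,l)` iff `j > l`, or `j = l` and `i > k`.
`varlt u v` says that the variable `x_u` is smaller than `x_v`. -/
def varlt (u v : ℤ × ℤ) : Prop := u.2 < v.2 ∨ (u.2 = v.2 ∧ u.1 < v.1)

/-- The vertices of `P`, as a type. -/
abbrev PVertex (P : Polyomino) : Type := {v : ℤ × ℤ // v ∈ P.vertexSet}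

/-- The polynomial ring `S_P = K[x_v : v ∈ V(P)]`. -/
abbrev PolyRing (K : Type) [Field K] (P : Polyomino) : Type := MvPolynomial (PVertex P) K

/-- The set of inner 2-minors of `P`. -/
def innerMinors (K : Type) [Field K] (P : Polyomino) : Set (PolyRing K P) :=
  { f | ∃ a b c d : PVertex P,
      IsInnerInterval P a.1 b.1 ∧ c.1 = (a.1.1, b.1.2) ∧ d.1 = (b.1.1, a.1.2) ∧
      f = MvPolynomial.X a * MvPolynomial.X b - MvPolynomial.X c * MvPolynomial.X d }

/-- The polyomino ideal `I_P`. -/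
def polyIdeal (K : Type) [Field K] (P : Polyomino) : Ideal (PolyRing K P) :=
  Ideal.span (innerMinors K P)

/-- The coordinate ring `K[P] = S_P / I_P`. -/
abbrev CoordRing (K : Type) [Field K] (P : Polyomino) : Type :=
  PolyRing K P ⧸ polyIdeal K P

/-! ## Monomial orders, initial ideals and Gröbner bases -/

/-- The (degree) reverse lexicographic order on monomials induced by the
variable order `vlt`: first compare total degrees; for equal total degrees,
`m₁ < m₂` iff the smallest variable whose exponents differ has a larger exponent in `m₁`. -/
def revlexLT {α : Type} (vlt : α → α → Prop) (m₁ m₂ : α →₀ ℕ) : Prop :=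
  (m₁.sum fun _ e => e) < (m₂.sum fun _ e => e) ∨
  ((m₁.sum fun _ e => e) = (m₂.sum fun _ e => e) ∧
    ∃ v, m₂ v < m₁ v ∧ ∀ w, vlt w v → m₁ w = m₂ w)

/-- The monomial order `<` on `S_P`. -/
def pmonLT (P : Polyomino) : (PVertex P →₀ ℕ) → (PVertex P →₀ ℕ) → Prop :=
  revlexLT fun u v => varlt u.1 v.1

/-- `m` is the leading monomial of `f` with respect to the monomial order `lt`. -/
def IsLeadMon {α K : Type} [CommSemiring K] (lt : (α →₀ ℕ) → (α →₀ ℕ) → Prop)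
    (f : MvPolynomial α K) (m : α →₀ ℕ) : Prop :=
  m ∈ f.support ∧ ∀ m' ∈ f.support, m' ≠ m → lt m' m

/-- The initial ideal of `I` with respect to the monomial order `lt`: the ideal generated by
the leading monomials of the nonzero elements of `I`. -/
def initialIdeal {α K : Type} [CommSemiring K] (lt : (α →₀ ℕ) → (α →₀ ℕ) → Prop)
    (I : Ideal (MvPolynomial α K)) : Ideal (MvPolynomial α K) :=
  Ideal.span { g | ∃ f ∈ I, f ≠ 0 ∧ ∃ m, IsLeadMon lt f m ∧ g = MvPolynomial.monomial m 1 }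

/-- The initial ideal `in_<(I_P)`. -/
def inIdeal (K : Type) [Field K] (P : Polyomino) : Ideal (PolyRing K P) :=
  initialIdeal (pmonLT P) (polyIdeal K P)

/-- `G` is a Gröbner basis of `I` with respect to `lt`. -/
def IsGroebnerBasis {α K : Type} [CommSemiring K] (lt : (α →₀ ℕ) → (α →₀ ℕ) → Prop)
    (G : Set (MvPolynomial α K)) (I : Ideal (MvPolynomial α K)) : Prop :=
  G ⊆ (I : Set (MvPolynomial α K)) ∧
  initialIdeal lt I =
    Ideal.span { g | ∃ f ∈ G, ∃ m, IsLeadMon lt f m ∧ g = MvPolynomial.monomial m 1 }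

/-- `G` is the reduced Gröbner basis of `I` with respect to `lt`: it is a Gröbner basis,
each element is monic, and no monomial occurring in an element of `G` is divisible by the
leading monomial of a different element of `G`. -/
def IsReducedGroebnerBasis {α K : Type} [CommSemiring K] (lt : (α →₀ ℕ) → (α →₀ ℕ) → Prop)
    (G : Set (MvPolynomial α K)) (I : Ideal (MvPolynomial α K)) : Prop :=
  IsGroebnerBasis lt G I ∧
  (∀ f ∈ G, ∃ m, IsLeadMon lt f m ∧ MvPolynomial.coeff m f = 1) ∧
  (∀ f ∈ G, ∀ m ∈ (f : MvPolynomial α K).support, ∀ f' ∈ G, f' ≠ f →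
    ∀ m', IsLeadMon lt f' m' → ¬ m' ≤ m)

/-! ## The simplicial complex Δ(P) -/

/-- The squarefree exponent vector supported on `W ∩ V(P)`. -/
def expOf (P : Polyomino) (W : Finset (ℤ × ℤ)) : PVertex P →₀ ℕ :=
  ∑ v ∈ P.vertexSet.attach, if v.1 ∈ W then Finsupp.single v 1 else 0

/-- `W` is a face of the simplicial complex `Δ(P)` whose Stanley–Reisner ideal is
`in_<(I_P)`: `W ⊆ V(P)` and the product of the variables indexed by `W` is not in
`in_<(I_P)`. -/
def IsFace (K : Type) [Field K] (P : Polyomino) (W : Finset (ℤ × ℤ)) : Prop :=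
  (↑W : Set (ℤ × ℤ)) ⊆ (↑P.vertexSet : Set (ℤ × ℤ)) ∧
  MvPolynomial.monomial (expOf P W) (1 : K) ∉ inIdeal K P

/-- `W` is a facet (maximal face) of `Δ(P)`. -/
def IsFacet (K : Type) [Field K] (P : Polyomino) (W : Finset (ℤ × ℤ)) : Prop :=
  IsFace K P W ∧ ∀ W' : Finset (ℤ × ℤ), IsFace K P W' → W ⊆ W' → W = W'

/-- `{p, q, r}` is a step of the face `W`, with lower right corner `q`. -/
def IsStep (P : Polyomino) (W : Finset (ℤ × ℤ)) (p q r : ℤ × ℤ) : Prop :=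
  p ∈ W ∧ q ∈ W ∧ r ∈ W ∧
  p.2 = q.2 ∧ q.1 = r.1 ∧ p.1 < q.1 ∧ q.2 < r.2 ∧
  (∀ w ∈ W, w.2 = p.2 → p.1 < w.1 → w.1 < q.1 → False) ∧
  (∀ w ∈ W, w.1 = q.1 → q.2 < w.2 → w.2 < r.2 → False) ∧
  (q.1 - 1, q.2) ∈ P.cells

/-- The number of steps of a face `W`. -/
def stepCount (P : Polyomino) (W : Finset (ℤ × ℤ)) : ℕ :=
  Set.ncard { t : (ℤ × ℤ) × (ℤ × ℤ) × (ℤ × ℤ) | IsStep P W t.1 t.2.1 t.2.2 }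

/-- The simplicial complex generated by a collection of subsets. -/
def genComplex (F : Set (Finset (ℤ × ℤ))) : Set (Finset (ℤ × ℤ)) :=
  { W | ∃ G ∈ F, W ⊆ G }

/-- The lexicographic order on facets: `flexLT F G` iff, listing the elements of `F` and `G`
in decreasing order with respect to the total order on `V(P)`, at the first position where
the lists differ the element of `F` is greater.  Equivalently, the largest element of the
symmetric difference belongs to `F`. -/
def flexLT (F G : Finset (ℤ × ℤ)) : Prop :=
  ∃ v, v ∈ F ∧ v ∉ G ∧ ∀ w, varlt v w → (w ∈ F ↔ w ∈ G)

/-- The facet `F₀` of `Δ(P)`. -/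
def FrameData.F0 (D : FrameData) : Finset (ℤ × ℤ) :=
  Finset.Icc ((1 : ℤ), (1 : ℤ)) (1, D.n) ∪ Finset.Icc ((1 : ℤ), D.n) (D.m, D.n) ∪
    (D.S2.toFinset \ {(D.a0, D.b0), (D.ak, D.bk)})

/-! ## Edge intervals -/

/-- The horizontal unit edge from `(x, y)` to `(x + 1, y)` is an edge of a cell of `P`. -/
def hEdge (P : Polyomino) (x y : ℤ) : Prop :=
  (x, y) ∈ P.cells ∨ (x, y - 1) ∈ P.cells

/-- The vertical unit edge from `(x, y)` to `(x, y + 1)` is an edge of a cell of `P`. -/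
def vEdge (P : Polyomino) (x y : ℤ) : Prop :=
  (x, y) ∈ P.cells ∨ (x - 1, y) ∈ P.cells

/-- `[(i, j), (k, j)]` is a maximal horizontal edge interval of `P`. -/
def IsMaxHEdgeInterval (P : Polyomino) (i k j : ℤ) : Prop :=
  i < k ∧ (∀ l, i ≤ l → l < k → hEdge P l j) ∧ ¬ hEdge P (i - 1) j ∧ ¬ hEdge P k j

/-- `[(x, j), (x, l)]` is a maximal vertical edge interval of `P`. -/
def IsMaxVEdgeInterval (P : Polyomino) (x j l : ℤ) : Prop :=
  j < l ∧ (∀ y, j ≤ y → y < l → vEdge P x y) ∧ ¬ vEdge P x (j - 1) ∧ ¬ vEdge P x l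

/-- The vertex set of the collection of cells of `P` contained in the interval `[a, b]`. -/
def boxVertexSet (P : Polyomino) (a b : ℤ × ℤ) : Set (ℤ × ℤ) :=
  { v | ∃ c ∈ P.cells, cellInInterval a b c ∧ v ∈ cellVertices c }

/-! ## Rook configurations -/

/-- Two (distinct) cells of `P` are in attacking position: they belong to the same row or
the same column of cells of `P`. -/
def attacking (P : Polyomino) (c d : ℤ × ℤ) : Prop :=
  c ≠ d ∧
  ((c.2 = d.2 ∧ ∀ x, min c.1 d.1 ≤ x → x ≤ max c.1 d.1 → (x, c.2) ∈ P.cells) ∨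
   (c.1 = d.1 ∧ ∀ y, min c.2 d.2 ≤ y → y ≤ max c.2 d.2 → (c.1, y) ∈ P.cells))

/-- `R` is a configuration of pairwise non-attacking rooks placed on cells of `P`. -/
def IsRookConfig (P : Polyomino) (R : Finset (ℤ × ℤ)) : Prop :=
  (↑R : Set (ℤ × ℤ)) ⊆ (↑P.cells : Set (ℤ × ℤ)) ∧ ∀ c ∈ R, ∀ d ∈ R, ¬ attacking P c d

/-- Two cells are the diagonal cells of an inner interval of `P`. -/
def diagPair (P : Polyomino) (c d : ℤ × ℤ) : Prop :=
  ∃ a b : ℤ × ℤ, IsInnerInterval P a b ∧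
    ((c = a ∧ d = (b.1 - 1, b.2 - 1)) ∨ (d = a ∧ c = (b.1 - 1, b.2 - 1)))

/-- Two cells are the anti-diagonal cells of an inner interval of `P`. -/
def antiDiagPair (P : Polyomino) (c d : ℤ × ℤ) : Prop :=
  ∃ a b : ℤ × ℤ, IsInnerInterval P a b ∧
    ((c = (a.1, b.2 - 1) ∧ d = (b.1 - 1, a.2)) ∨ (d = (a.1, b.2 - 1) ∧ c = (b.1 - 1, a.2)))

/-- One switch: replace two rooks placed on the diagonal cells of an inner interval by rooks
on its anti-diagonal cells, or vice versa. -/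
def switchStep (P : Polyomino) (R R' : Finset (ℤ × ℤ)) : Prop :=
  ∃ a b : ℤ × ℤ, IsInnerInterval P a b ∧
    ((a ∈ R ∧ (b.1 - 1, b.2 - 1) ∈ R ∧
      R' = insert (a.1, b.2 - 1) (insert (b.1 - 1, a.2)
        ((R.erase a).erase (b.1 - 1, b.2 - 1)))) ∨
     ((a.1, b.2 - 1) ∈ R ∧ (b.1 - 1, a.2) ∈ R ∧
      R' = insert a (insert (b.1 - 1, b.2 - 1)
        ((R.erase (a.1, b.2 - 1)).erase (b.1 - 1, a.2)))))

/-- A canonical configuration: no two rooks are in anti-diagonal position. -/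
def IsCanonical (P : Polyomino) (R : Finset (ℤ × ℤ)) : Prop :=
  ∀ c ∈ R, ∀ d ∈ R, ¬ antiDiagPair P c d

/-- The `k`-rook configurations of `P`, as a type. -/
def RookConfigType (P : Polyomino) (k : ℕ) : Type :=
  { R : Finset (ℤ × ℤ) // IsRookConfig P R ∧ R.card = k }

/-- `r̃_k`: the number of equivalence classes of `k`-rook configurations of `P` under the
equivalence generated by switches. -/
def rtil (P : Polyomino) (k : ℕ) : ℕ :=
  Nat.card (Quot fun R S : RookConfigType P k => switchStep P R.1 S.1)

/-- The rook number of `P`: the maximum number of pairwise non-attacking rooks in `P`. -/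
def rookNumber (P : Polyomino) : ℕ :=
  sSup { k | ∃ R : Finset (ℤ × ℤ), IsRookConfig P R ∧ R.card = k }

/-! ## Hilbert functions -/

/-- The Hilbert function of the standard graded algebra `K[P]`. -/
def hilbertFunction (K : Type) [Field K] (P : Polyomino) (k : ℕ) : ℕ :=
  Module.finrank K
    (Submodule.map (Ideal.Quotient.mkₐ K (polyIdeal K P)).toLinearMap
      (MvPolynomial.homogeneousSubmodule (PVertex P) K k))

/-- The Hilbert–Poincaré series of `K[P]`, as a power series over `ℤ`. -/
def hilbertSeries (K : Type) [Field K] (P : Polyomino) : PowerSeries ℤ :=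
  PowerSeries.mk fun k => (hilbertFunction K P k : ℤ)

set_option synthInstance.maxHeartbeats 1000000 in
/-- `K[P]` is Cohen–Macaulay: there exists a regular sequence, consisting of elements of the
irrelevant maximal ideal, whose length equals the Krull dimension of `K[P]`. -/
def IsCMCoordRing (K : Type) [Field K] (P : Polyomino) : Prop :=
  ∃ rs : List (CoordRing K P),
    RingTheory.Sequence.IsRegular (CoordRing K P) rs ∧
    (∀ r ∈ rs, r ∈ Ideal.map (Ideal.Quotient.mk (polyIdeal K P))
      (Ideal.span (Set.range (MvPolynomial.X : PVertex P → PolyRing K P)))) ∧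
    (rs.length : WithBot (WithTop ℕ)) = ringKrullDim (CoordRing K P)

/-! ## Maximal chains and descents (for parallelogram polyominoes) -/

/-- `C` is a maximal chain of the poset `V(P)` (with the componentwise order). -/
def IsMaximalChainOn (P : Polyomino) (C : Finset (ℤ × ℤ)) : Prop :=
  (↑C : Set (ℤ × ℤ)) ⊆ (↑P.vertexSet : Set (ℤ × ℤ)) ∧
  IsChain (· ≤ ·) (↑C : Set (ℤ × ℤ)) ∧
  ∀ C' : Finset (ℤ × ℤ), (↑C' : Set (ℤ × ℤ)) ⊆ (↑P.vertexSet : Set (ℤ × ℤ)) →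
    IsChain (· ≤ ·) (↑C' : Set (ℤ × ℤ)) → C ⊆ C' → C = C'

/-- The chain `C` has a descent at the cell of `P` with lower left corner `c`. -/
def descentAt (P : Polyomino) (C : Finset (ℤ × ℤ)) (c : ℤ × ℤ) : Prop :=
  c ∈ P.cells ∧ c ∈ C ∧ (c.1 + 1, c.2) ∈ C ∧ (c.1 + 1, c.2 + 1) ∈ C

/-- The number of descents of the chain `C`. -/
def descentCount (P : Polyomino) (C : Finset (ℤ × ℤ)) : ℕ :=
  Set.ncard { c : ℤ × ℤ | descentAt P C c }

/-! ## Minimal graded free resolutions and Castelnuovo–Mumford regularity -/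

/-- A finite minimal graded free resolution of `S_P / I` over `S_P`:
`F_d = ⊕_{i} S_P(-tw d i)` with `F_0 = S_P`, differentials given by matrices of homogeneous
polynomials of the appropriate degrees with entries in the irrelevant maximal ideal,
exact away from homological degree `0` and with image `I` in homological degree `0`. -/
structure MinimalGradedFreeResolution (K : Type) [Field K] (P : Polyomino)
    (I : Ideal (PolyRing K P)) : Type where
  len : ℕ
  t : ℕ → ℕ
  tw : (d : ℕ) → Fin (t d) → ℤ
  mat : (d : ℕ) → Matrix (Fin (t d)) (Fin (t (d + 1))) (PolyRing K P)
  t0 : t 0 = 1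
  tw0 : ∀ i, tw 0 i = 0
  finite : ∀ d, len < d → t d = 0
  graded : ∀ d i j, mat d i j = 0 ∨
    ∃ e : ℕ, (e : ℤ) = tw (d + 1) j - tw d i ∧ (mat d i j).IsHomogeneous e
  minimal : ∀ d i j, MvPolynomial.coeff 0 (mat d i j) = 0
  aug : LinearMap.range (mat 0).mulVecLin =
    Submodule.pi Set.univ (fun _ : Fin (t 0) => I)
  isexact : ∀ d, LinearMap.range (mat (d + 1)).mulVecLin = LinearMap.ker (mat d).mulVecLin

end

/-! ## Combinatorial part -/

/-- All cells of the box `[x1,x2] × [y1,y2]` belong to `P`. -/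
def Inn (P : Polyomino) (x1 x2 y1 y2 : ℤ) : Prop :=
  ∀ x y, x1 ≤ x → x < x2 → y1 ≤ y → y < y2 → (x, y) ∈ P.cells

theorem Inn.mono {P : Polyomino} {x1 x2 y1 y2 x1' x2' y1' y2' : ℤ} (h : Inn P x1 x2 y1 y2)
    (h1 : x1 ≤ x1') (h2 : x2' ≤ x2) (h3 : y1 ≤ y1') (h4 : y2' ≤ y2) : Inn P x1' x2' y1' y2' :=
  fun x y a b c d => h x y (by omega) (by omega) (by omega) (by omega)

theorem Inn.hj {P : Polyomino} {x1 x2 x3 y1 y2 : ℤ} (h : Inn P x1 x2 y1 y2)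
    (h' : Inn P x2 x3 y1 y2) : Inn P x1 x3 y1 y2 := fun x y a b c d => by
  by_cases hx : x < x2
  · exact h x y a hx c d
  · exact h' x y (by omega) b c d

theorem Inn.vj {P : Polyomino} {x1 x2 y1 y2 y3 : ℤ} (h : Inn P x1 x2 y1 y2)
    (h' : Inn P x1 x2 y2 y3) : Inn P x1 x2 y1 y3 := fun x y a b c d => by
  by_cases hx : y < y2
  · exact h x y a b c hx
  · exact h' x y a b (by omega) d

/-- The points `c` (upper left) and `d` (lower right) are the anti-diagonal corners of an inner
interval. -/
def Cf (P : Polyomino) (c d : ℤ × ℤ) : Prop :=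
  c.1 < d.1 ∧ d.2 < c.2 ∧ Inn P c.1 d.1 d.2 c.2

/-- The crossing property of frame polyominoes. -/
def QProp (P : Polyomino) : Prop :=
  ∀ x1 x2 x3 y1 y2 y3 : ℤ, x1 < x2 → x2 < x3 → y1 < y2 → y2 < y3 →
    Inn P x1 x2 y2 y3 → Inn P x2 x3 y1 y2 → Inn P x1 x2 y1 y2 ∨ Inn P x2 x3 y2 y3

theorem mem_vertexSet_iff (P : Polyomino) (x y : ℤ) : (x, y) ∈ P.vertexSet ↔
    (x, y) ∈ P.cells ∨ (x - 1, y) ∈ P.cells ∨ (x, y - 1) ∈ P.cells ∨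
      (x - 1, y - 1) ∈ P.cells := by
  simp only [Polyomino.vertexSet, Finset.mem_biUnion, cellVertices, Finset.mem_insert,
    Finset.mem_singleton, Prod.exists, Prod.mk.injEq]
  constructor
  · rintro ⟨a, b, h, ⟨rfl, rfl⟩ | ⟨rfl, rfl⟩ | ⟨rfl, rfl⟩ | ⟨rfl, rfl⟩⟩ <;> simp [h]
  · rintro (h | h | h | h)
    · exact ⟨_, _, h, by simp⟩
    · exact ⟨_, _, h, by simp⟩
    · exact ⟨_, _, h, by simp⟩
    · exact ⟨_, _, h, by simp⟩

theorem Inn.mem {P : Polyomino} {x1 x2 y1 y2 x y : ℤ} (h : Inn P x1 x2 y1 y2)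
    (hx : x1 < x2) (hy : y1 < y2) (h1 : x1 ≤ x) (h2 : x ≤ x2) (h3 : y1 ≤ y) (h4 : y ≤ y2) :
    (x, y) ∈ P.vertexSet := by
  rw [mem_vertexSet_iff]
  by_cases hx' : x < x2 <;> by_cases hy' : y < y2
  · exact Or.inl (h _ _ h1 hx' h3 hy')
  · exact Or.inr (Or.inr (Or.inl (h _ _ h1 hx' (by omega) (by omega))))
  · exact Or.inr (Or.inl (h _ _ (by omega) (by omega) h3 hy'))
  · exact Or.inr (Or.inr (Or.inr (h _ _ (by omega) (by omega) (by omega) (by omega))))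

/-- Combinatorial faces. -/
def CFace (P : Polyomino) (W : Finset (ℤ × ℤ)) : Prop :=
  W ⊆ P.vertexSet ∧ ∀ c ∈ W, ∀ d ∈ W, ¬ Cf P c d

/-- Combinatorial facets. -/
def CFacet (P : Polyomino) (W : Finset (ℤ × ℤ)) : Prop :=
  CFace P W ∧ ∀ W', CFace P W' → W ⊆ W' → W = W'

theorem Cf.irrefl {P : Polyomino} (c : ℤ × ℤ) : ¬ Cf P c c := fun h => lt_irrefl _ h.1

theorem CFacet.exists_conflict {P : Polyomino} {F : Finset (ℤ × ℤ)} (hF : CFacet P F)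
    {u : ℤ × ℤ} (hu : u ∈ P.vertexSet) (huF : u ∉ F) : ∃ f ∈ F, Cf P f u ∨ Cf P u f := by
  by_contra hcon
  push Not at hcon
  have : CFace P (insert u F) := by
    refine ⟨Finset.insert_subset hu hF.1.1, ?_⟩
    intro c hc d hd
    rw [Finset.mem_insert] at hc hd
    rcases hc with rfl | hc <;> rcases hd with rfl | hd
    · exact Cf.irrefl _
    · exact (hcon d hd).2
    · exact (hcon c hc).1
    · exact hF.1.2 c hc d hd
  have := hF.2 _ this (Finset.subset_insert _ _)
  exact huF (this ▸ Finset.mem_insert_self _ _)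

open Classical in
/-- Moving `d` so that it has a unique upper left conflict. -/
theorem exists_unique_UL {P : Polyomino} {F : Finset (ℤ × ℤ)} (hF : CFace P F) :
    ∀ (N : ℕ) (r s : ℤ), (F.filter fun f => f.1 < r ∧ s < f.2 ∧ Inn P f.1 r s f.2).card = N →
    (∃ f ∈ F, Cf P f (r, s)) →
    ∃ v ∈ F, Cf P v (r, s) ∧ ∃ r' s', Cf P v (r', s') ∧ ∀ f ∈ F, Cf P f (r', s') → f = v := by
  intro N
  induction N using Nat.strong_induction_on with
  | _ N ih =>
  rintro r s hN ⟨⟨p, q⟩, hpF, hp⟩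
  by_cases huniq : ∀ f ∈ F, Cf P f (r, s) → f = (p, q)
  · exact ⟨(p, q), hpF, hp, r, s, hp, huniq⟩
  push Not at huniq
  obtain ⟨⟨p', q'⟩, hpF', hp', hne⟩ := huniq
  -- reduce to a comparable pair
  have key : ∀ f1 f2 g1 g2 : ℤ, (f1, f2) ∈ F → (g1, g2) ∈ F → Cf P (f1, f2) (r, s) →
      Cf P (g1, g2) (r, s) → (f1, f2) ≠ (g1, g2) → f1 ≤ g1 → f2 ≤ g2 →
      ∃ v ∈ F, Cf P v (r, s) ∧
        ∃ r' s', Cf P v (r', s') ∧ ∀ f ∈ F, Cf P f (r', s') → f = v := by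
    intro f1 f2 g1 g2 hfF hgF hf hg hfg h1 h2
    obtain ⟨hf1, hf2, hf3⟩ := hf
    obtain ⟨hg1, hg2, hg3⟩ := hg
    simp only at hf1 hf2 hf3 hg1 hg2 hg3
    have finish : ∀ r' s' : ℤ, (∀ e ∈ F, Cf P e (r', s') → Cf P e (r, s)) →
        (∃ e ∈ F, Cf P e (r, s) ∧ ¬ Cf P e (r', s')) → (∃ e ∈ F, Cf P e (r', s')) →
        ∃ v ∈ F, Cf P v (r, s) ∧
          ∃ r' s', Cf P v (r', s') ∧ ∀ f ∈ F, Cf P f (r', s') → f = v := by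
      intro r' s' hsub ⟨e, heF, he1, he2⟩ hex
      have hlt : (F.filter fun f => f.1 < r' ∧ s' < f.2 ∧ Inn P f.1 r' s' f.2).card < N := by
        rw [← hN]
        apply Finset.card_lt_card
        rw [Finset.ssubset_iff_of_subset]
        · exact ⟨e, by simpa using ⟨heF, he1⟩, by
            simp only [Finset.mem_filter, not_and]
            intro _ a b c
            exact he2 ⟨a, b, c⟩⟩
        · intro x hx
          rw [Finset.mem_filter] at hx ⊢
          exact ⟨hx.1, hsub x hx.1 hx.2⟩
      obtain ⟨v, hvF, hv, rest⟩ := ih _ hlt r' s' rfl hex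
      exact ⟨v, hvF, hsub v hvF hv, rest⟩
    rcases lt_or_eq_of_le h1 with h1 | h1
    · refine finish g1 s ?_ ⟨_, hgF, ⟨hg1, hg2, hg3⟩, fun h => lt_irrefl _ h.1⟩
        ⟨_, hfF, h1, hf2, hf3.mono le_rfl hg1.le le_rfl le_rfl⟩
      rintro ⟨e1, e2⟩ heF ⟨he1, he2, he3⟩
      simp only at he1 he2 he3
      by_cases h : e2 ≤ g2
      · exact ⟨he1.trans hg1, he2, he3.hj (hg3.mono le_rfl le_rfl le_rfl h)⟩
      · exact absurd ⟨he1, by simpa using h, he3.mono le_rfl le_rfl hg2.le le_rfl⟩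
          (hF.2 _ heF _ hgF)
    · subst h1
      have h2 : f2 < g2 := lt_of_le_of_ne h2 (fun h => hfg (by rw [h]))
      refine finish r f2 ?_ ⟨_, hfF, ⟨hf1, hf2, hf3⟩, fun h => lt_irrefl _ h.2.1⟩
        ⟨_, hgF, hg1, h2, hg3.mono le_rfl le_rfl hf2.le le_rfl⟩
      rintro ⟨e1, e2⟩ heF ⟨he1, he2, he3⟩
      simp only at he1 he2 he3
      by_cases h : f1 ≤ e1
      · exact ⟨he1, hf2.trans he2, (hf3.mono h le_rfl le_rfl le_rfl).vj he3⟩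
      · exact absurd ⟨by simpa using h, he2, he3.mono le_rfl hf1.le le_rfl le_rfl⟩
          (hF.2 _ heF _ hfF)
  have nc1 := hF.2 _ hpF _ hpF'
  have nc2 := hF.2 _ hpF' _ hpF
  obtain ⟨a1, a2, a3⟩ := id hp
  obtain ⟨b1, b2, b3⟩ := id hp'
  simp only at a1 a2 a3 b1 b2 b3
  rcases le_or_gt p p' with hpp | hpp
  · rcases le_or_gt q q' with hqq | hqq
    · exact key p q p' q' hpF hpF' hp hp' (Ne.symm hne) hpp hqq
    · rcases lt_or_eq_of_le hpp with hpp | hpp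
      · exact absurd ⟨hpp, hqq, a3.mono le_rfl b1.le b2.le le_rfl⟩ nc1
      · exact key p' q' p q hpF' hpF hp' hp hne hpp.ge hqq.le
  · rcases le_or_gt q' q with hqq | hqq
    · exact key p' q' p q hpF' hpF hp' hp hne hpp.le hqq
    · exact absurd ⟨hpp, hqq, b3.mono le_rfl a1.le a2.le le_rfl⟩ nc2

/-- Moving `d` so that it has no lower right conflict. -/
theorem exists_sole {P : Polyomino} (Q : QProp P) {F : Finset (ℤ × ℤ)} (hF : CFace P F)
    {p q : ℤ} (hv : (p, q) ∈ F) :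
    ∀ (N : ℕ) (r s : ℤ), (F.filter fun f => r < f.1 ∧ f.2 < s).card = N →
    Cf P (p, q) (r, s) → (∀ f ∈ F, Cf P f (r, s) → f = (p, q)) →
    ∃ r' s', Cf P (p, q) (r', s') ∧ (∀ f ∈ F, Cf P f (r', s') → f = (p, q)) ∧
      ∀ f ∈ F, ¬ Cf P (r', s') f := by
  intro N
  induction N using Nat.strong_induction_on with
  | _ N ih =>
  intro r s hN hc hu
  by_cases hno : ∀ f ∈ F, ¬ Cf P (r, s) f
  · exact ⟨r, s, hc, hu, hno⟩
  push Not at hno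
  obtain ⟨⟨f1, f2⟩, hfF, hf1, hf2, hf3⟩ := hno
  obtain ⟨c1, c2, c3⟩ := id hc
  simp only at hf1 hf2 hf3 c1 c2 c3
  have dec : ∀ r' s', r ≤ r' → s' ≤ s → (r' = f1 ∨ s' = f2) →
      (F.filter fun f => r' < f.1 ∧ f.2 < s').card < N := by
    intro r' s' h1 h2 h3
    rw [← hN]
    apply Finset.card_lt_card
    rw [Finset.ssubset_iff_of_subset]
    · refine ⟨(f1, f2), by simp [hfF, hf1, hf2], ?_⟩
      simp only [Finset.mem_filter, not_and]
      intro _ h4 h5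
      rcases h3 with h3 | h3 <;> omega
    · intro x hx
      rw [Finset.mem_filter] at hx ⊢
      exact ⟨hx.1, by omega, by omega⟩
  rcases Q p r f1 f2 s q c1 hf1 hf2 c2 c3 hf3 with h | h
  · refine ih _ (dec r f2 le_rfl hf2.le (Or.inr rfl)) r f2 rfl ⟨c1, hf2.trans c2, h.vj c3⟩ ?_
    rintro ⟨e1, e2⟩ heF ⟨he1, he2, he3⟩
    simp only at he1 he2 he3
    rcases le_or_gt e2 s with h5 | h5
    · exact absurd ⟨he1.trans hf1, he2, he3.hj (hf3.mono le_rfl le_rfl le_rfl h5)⟩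
        (hF.2 _ heF _ hfF)
    · exact hu _ heF ⟨he1, h5, he3.mono le_rfl le_rfl hf2.le le_rfl⟩
  · refine ih _ (dec f1 s hf1.le le_rfl (Or.inl rfl)) f1 s rfl ⟨c1.trans hf1, c2, c3.hj h⟩ ?_
    rintro ⟨e1, e2⟩ heF ⟨he1, he2, he3⟩
    simp only at he1 he2 he3
    rcases le_or_gt r e1 with h5 | h5
    · exact absurd ⟨he1, hf2.trans he2, (hf3.mono h5 le_rfl le_rfl le_rfl).vj he3⟩
        (hF.2 _ heF _ hfF)
    · exact hu _ heF ⟨h5, he2, he3.mono le_rfl hf1.le le_rfl le_rfl⟩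

/-- If `(p,q)` is the sole conflict of `(r,s)` in the facet `F`, then the two diagonal corners
of the interval are in `F`. -/
theorem corners_mem {P : Polyomino} {F : Finset (ℤ × ℤ)} (hF : CFacet P F)
    {p q r s : ℤ} (hv : (p, q) ∈ F) (hc : Cf P (p, q) (r, s))
    (hu : ∀ f ∈ F, Cf P f (r, s) → f = (p, q)) (hl : ∀ f ∈ F, ¬ Cf P (r, s) f) :
    (r, q) ∈ F ∧ (p, s) ∈ F := by
  obtain ⟨c1, c2, c3⟩ := hc
  simp only at c1 c2 c3
  constructor
  · by_contra hn
    obtain ⟨⟨f1, f2⟩, hfF, ⟨h1, h2, h3⟩ | ⟨h1, h2, h3⟩⟩ := hF.exists_conflict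
      (c3.mem c1 c2 c1.le le_rfl c2.le le_rfl) hn
    all_goals simp only at h1 h2 h3
    · rcases lt_or_ge f1 p with h | h
      · exact hF.1.2 _ hfF _ hv ⟨h, h2, h3.mono le_rfl c1.le le_rfl le_rfl⟩
      · have := hu _ hfF ⟨h1, c2.trans h2, (c3.mono h le_rfl le_rfl le_rfl).vj h3⟩
        simp only [Prod.mk.injEq] at this
        omega
    · rcases lt_or_ge f2 s with h | h
      · exact hl _ hfF ⟨h1, h, h3.mono le_rfl le_rfl le_rfl c2.le⟩
      · exact hF.1.2 _ hv _ hfF ⟨c1.trans h1, h2, (c3.mono le_rfl le_rfl h le_rfl).hj h3⟩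
  · by_contra hn
    obtain ⟨⟨f1, f2⟩, hfF, ⟨h1, h2, h3⟩ | ⟨h1, h2, h3⟩⟩ := hF.exists_conflict
      (c3.mem c1 c2 le_rfl c1.le le_rfl c2.le) hn
    all_goals simp only at h1 h2 h3
    · rcases lt_or_ge q f2 with h | h
      · exact hF.1.2 _ hfF _ hv ⟨h1, h, h3.mono le_rfl le_rfl c2.le le_rfl⟩
      · have := hu _ hfF ⟨h1.trans c1, h2, h3.hj (c3.mono le_rfl le_rfl le_rfl h)⟩
        simp only [Prod.mk.injEq] at this
        omega
    · rcases lt_or_ge r f1 with h | h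
      · exact hl _ hfF ⟨h, h2, h3.mono c1.le le_rfl le_rfl le_rfl⟩
      · exact hF.1.2 _ hv _ hfF ⟨h1, h2.trans c2, h3.vj (c3.mono le_rfl h le_rfl le_rfl)⟩

/-- The swapped set is a facet. -/
theorem swap_facet {P : Polyomino} (Q : QProp P) {F : Finset (ℤ × ℤ)} (hF : CFacet P F)
    {p q r s : ℤ} (hv : (p, q) ∈ F) (hc : Cf P (p, q) (r, s))
    (hu : ∀ f ∈ F, Cf P f (r, s) → f = (p, q)) (hl : ∀ f ∈ F, ¬ Cf P (r, s) f) :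
    CFacet P (insert (r, s) (F.erase (p, q))) := by
  obtain ⟨hb, ha⟩ := corners_mem hF hv hc hu hl
  obtain ⟨c1, c2, c3⟩ := id hc
  simp only at c1 c2 c3
  have hwV : (r, s) ∈ P.vertexSet := c3.mem c1 c2 c1.le le_rfl le_rfl c2.le
  have hface : CFace P (insert (r, s) (F.erase (p, q))) := by
    refine ⟨Finset.insert_subset hwV ((Finset.erase_subset _ _).trans hF.1.1), ?_⟩
    intro c hc d hd
    rw [Finset.mem_insert, Finset.mem_erase] at hc hd
    rcases hc with rfl | hc <;> rcases hd with rfl | hd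
    · exact Cf.irrefl _
    · exact hl d hd.2
    · exact fun h => hc.1 (hu c hc.2 h)
    · exact hF.1.2 c hc.2 d hd.2
  refine ⟨hface, fun W hW hsub => ?_⟩
  have hwW : (r, s) ∈ W := hsub (Finset.mem_insert_self _ _)
  have hFW : ∀ f ∈ F, f ≠ (p, q) → f ∈ W := fun f hf hne =>
    hsub (Finset.mem_insert_of_mem (Finset.mem_erase.2 ⟨hne, hf⟩))
  have hvW : (p, q) ∉ W := fun h => hW.2 _ h _ hwW hc
  refine Finset.Subset.antisymm hsub fun z hz => ?_
  rw [Finset.mem_insert, Finset.mem_erase]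
  by_contra hcon
  push Not at hcon
  obtain ⟨hzw, hzF⟩ := hcon
  have hzv : z ≠ (p, q) := fun h => hvW (h ▸ hz)
  have hzF := fun h => hzF hzv h
  -- `z` has the sole conflict `(p,q)`
  have hzc : ∀ f ∈ F, Cf P f z ∨ Cf P z f → f = (p, q) := by
    intro f hf h
    by_contra hne
    rcases h with h | h
    · exact hW.2 _ (hFW f hf hne) _ hz h
    · exact hW.2 _ hz _ (hFW f hf hne) h
  obtain ⟨zx, zy⟩ := z
  obtain ⟨f, hfF, hfz⟩ := hF.exists_conflict (hW.1 hz) hzF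
  have hfv := hzc f hfF hfz
  subst hfv
  rcases hfz with hfz | hfz
  · have hu' : ∀ f ∈ F, Cf P f (zx, zy) → f = (p, q) := fun f hf h => hzc f hf (Or.inl h)
    have hl' : ∀ f ∈ F, ¬ Cf P (zx, zy) f := by
      intro f hf h
      have h' := hzc f hf (Or.inr h)
      subst h'
      have h1 := h.1
      have h2 := hfz.1
      simp only at h1 h2
      omega
    obtain ⟨hb', ha'⟩ := corners_mem hF hv hfz hu' hl'
    obtain ⟨d1, d2, d3⟩ := hfz
    simp only at d1 d2 d3
    rcases lt_trichotomy r zx with h | h | h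
    · have := hu' _ hb ⟨h, d2, d3.mono c1.le le_rfl le_rfl le_rfl⟩
      simp only [Prod.mk.injEq] at this
      omega
    · subst h
      rcases lt_trichotomy s zy with h | h | h
      · have := hu _ ha' ⟨c1, h, c3.mono le_rfl le_rfl le_rfl d2.le⟩
        simp only [Prod.mk.injEq] at this
        omega
      · exact hzw (by rw [h])
      · have := hu' _ ha ⟨c1, h, d3.mono le_rfl le_rfl le_rfl c2.le⟩
        simp only [Prod.mk.injEq] at this
        omega
    · have := hu _ hb' ⟨h, c2, c3.mono d1.le le_rfl le_rfl le_rfl⟩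
      simp only [Prod.mk.injEq] at this
      omega
  · obtain ⟨d1, d2, d3⟩ := hfz
    simp only at d1 d2 d3
    rcases Q zx p r s q zy d1 c1 c2 d2 d3 c3 with h | h
    · have := hzc _ ha (Or.inr ⟨d1, c2.trans d2, h.vj d3⟩)
      simp only [Prod.mk.injEq] at this
      omega
    · have := hzc _ hb (Or.inr ⟨d1.trans c1, d2, d3.hj h⟩)
      simp only [Prod.mk.injEq] at this
      omega

/-- The exchange lemma. -/
theorem exchange {P : Polyomino} (Q : QProp P) {F G : Finset (ℤ × ℤ)} (hF : CFacet P F)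
    (hG : CFacet P G) (hFG : flexLT F G) :
    ∃ v ∈ F, v ∉ G ∧ ∃ w, w ∉ F ∧ w.2 < v.2 ∧ CFacet P (insert w (F.erase v)) := by
  obtain ⟨v, hvF, hvG, hmax⟩ := hFG
  obtain ⟨⟨r, s⟩, hg, h | h⟩ := hG.exists_conflict (hF.1.1 hvF) hvG
  · exact absurd h (hF.1.2 _ ((hmax _ (Or.inl h.2.1)).2 hg) _ hvF)
  obtain ⟨⟨p, q⟩, hpF, hp, r1, s1, h1, h2⟩ := exists_unique_UL hF.1 _ r s rfl ⟨v, hvF, h⟩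
  obtain ⟨r2, s2, h3, h4, h5⟩ := exists_sole Q hF.1 hpF _ r1 s1 rfl h1 h2
  exact ⟨(p, q), hpF, fun h => hG.1.2 _ h _ hg hp, (r2, s2), fun h => hF.1.2 _ hpF _ h h3,
    h3.2.1, swap_facet Q hF hpF h3 h4 h5⟩

theorem varlt_irrefl (v : ℤ × ℤ) : ¬ varlt v v := by simp [varlt]

theorem varlt_trans {u v w : ℤ × ℤ} (h1 : varlt u v) (h2 : varlt v w) : varlt u w := by
  unfold varlt at *; omega

theorem varlt_total (u v : ℤ × ℤ) : varlt u v ∨ u = v ∨ varlt v u := by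
  obtain ⟨a, b⟩ := u
  obtain ⟨c, d⟩ := v
  simp only [varlt, Prod.mk.injEq]
  omega

theorem flexLT_total {F G : Finset (ℤ × ℤ)} (h : F ≠ G) : flexLT F G ∨ flexLT G F := by
  have hne : (symmDiff F G).Nonempty := by
    rw [Finset.nonempty_iff_ne_empty]
    intro h'
    exact h (symmDiff_eq_bot.1 h')
  obtain ⟨v, hv, hmax⟩ := Finset.exists_max_image (symmDiff F G)
    (fun v => toLex (v.2, v.1)) hne
  have hmax' : ∀ w, varlt v w → (w ∈ F ↔ w ∈ G) := by
    intro w hw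
    by_contra hcon
    have hwm : w ∈ symmDiff F G := by
      rw [Finset.mem_symmDiff]; tauto
    have := hmax w hwm
    rw [Prod.Lex.toLex_le_toLex] at this
    unfold varlt at hw
    simp only at this
    omega
  rw [Finset.mem_symmDiff] at hv
  rcases hv with hv | hv
  · exact Or.inl ⟨v, hv.1, hv.2, hmax'⟩
  · exact Or.inr ⟨v, hv.1, hv.2, fun w hw => (hmax' w hw).symm⟩

theorem pure_aux {P : Polyomino} (Q : QProp P) (hpos : ∀ v ∈ P.vertexSet, (0 : ℤ) ≤ v.2) :
    ∀ (N : ℕ) (F G : Finset (ℤ × ℤ)), CFacet P F → CFacet P G →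
      (∑ v ∈ F, v.2.toNat) + (∑ v ∈ G, v.2.toNat) = N → F.card = G.card := by
  intro N
  induction N using Nat.strong_induction_on with
  | _ N ih =>
  have step : ∀ F G : Finset (ℤ × ℤ), CFacet P F → CFacet P G → flexLT F G →
      ∃ F', CFacet P F' ∧ F'.card = F.card ∧ ∑ v ∈ F', v.2.toNat < ∑ v ∈ F, v.2.toNat := by
    intro F G hF hG h
    obtain ⟨v, hv, -, w, hw, hlt, hF'⟩ := exchange Q hF hG h
    have hwe : w ∉ F.erase v := fun h => hw (Finset.mem_of_mem_erase h)
    refine ⟨_, hF', ?_, ?_⟩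
    · rw [Finset.card_insert_of_notMem hwe, Finset.card_erase_add_one hv]
    · rw [Finset.sum_insert hwe, ← Finset.add_sum_erase F _ hv]
      have := hpos w (hF'.1.1 (Finset.mem_insert_self _ _))
      have : w.2.toNat < v.2.toNat := by omega
      omega
  intro F G hF hG hN
  by_cases hFG : F = G
  · rw [hFG]
  rcases flexLT_total hFG with h | h
  · obtain ⟨F', h1, h2, h3⟩ := step F G hF hG h
    rw [← h2]
    exact ih _ (by omega) F' G h1 hG rfl
  · obtain ⟨G', h1, h2, h3⟩ := step G F hG hF h
    rw [← h2]
    exact ih _ (by omega) F G' hF h1 rfl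

theorem shelling_aux {P : Polyomino} (Q : QProp P) (F : Finset (ℤ × ℤ)) (hF : CFacet P F)
    (hex : ∃ G, CFacet P G ∧ flexLT F G) :
    ∃ M : Set (Finset (ℤ × ℤ)), M.Nonempty ∧ (∀ W ∈ M, ∃ v ∈ F, W = F.erase v) ∧
        genComplex { G | CFacet P G ∧ flexLT F G } ∩ genComplex {F} = genComplex M := by
  have main : ∀ G, CFacet P G → flexLT F G → ∃ v ∈ F, v ∉ G ∧
      ∃ G', CFacet P G' ∧ flexLT F G' ∧ F.erase v ⊆ G' := by
    intro G hG h
    obtain ⟨v, hv, hvG, w, hw, hlt, hF'⟩ := exchange Q hF hG h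
    refine ⟨v, hv, hvG, _, hF', ⟨v, hv, ?_, ?_⟩, Finset.subset_insert _ _⟩
    · rw [Finset.mem_insert, Finset.mem_erase]
      rintro (h | h)
      · exact hw (h ▸ hv)
      · exact h.1 rfl
    · intro u hu
      have h1 : u ≠ v := fun h => varlt_irrefl v (h ▸ hu)
      have h2 : u ≠ w := by
        rintro rfl
        unfold varlt at hu
        omega
      simp [h1, h2]
  refine ⟨{W | ∃ v ∈ F, W = F.erase v ∧ ∃ G', CFacet P G' ∧ flexLT F G' ∧ F.erase v ⊆ G'},
    ?_, ?_, ?_⟩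
  · obtain ⟨G, hG, h⟩ := hex
    obtain ⟨v, hv, -, h⟩ := main G hG h
    exact ⟨_, v, hv, rfl, h⟩
  · rintro W ⟨v, hv, h, -⟩
    exact ⟨v, hv, h⟩
  · ext W
    constructor
    · rintro ⟨⟨G, ⟨hG, hlt⟩, hWG⟩, F', rfl, hWF⟩
      obtain ⟨v, hv, hvG, h⟩ := main G hG hlt
      exact ⟨_, ⟨v, hv, rfl, h⟩, Finset.subset_erase.2 ⟨hWF, fun h => hvG (hWG h)⟩⟩
    · rintro ⟨_, ⟨v, hv, rfl, G', h1, h2, h3⟩, hW⟩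
      exact ⟨⟨G', ⟨h1, h2⟩, hW.trans h3⟩, F, rfl, hW.trans (Finset.erase_subset _ _)⟩

/-! ## The crossing property for frames -/

/-- The step relation of north-east paths. -/
def neStep (u v : ℤ × ℤ) : Prop := v = (u.1 + 1, u.2) ∨ v = (u.1, u.2 + 1)

theorem ne_bounds : ∀ (L : List (ℤ × ℤ)) (a b : ℤ × ℤ), L.IsChain neStep → L.head? = some a →
    L.getLast? = some b → ∀ p ∈ L, a.1 ≤ p.1 ∧ p.1 ≤ b.1 := by
  intro L
  induction L with
  | nil => intro a b _ h; simp at h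
  | cons u L ih =>
    intro a b hc ha hb p hp
    simp only [List.head?_cons, Option.some.injEq] at ha
    subst ha
    cases L with
    | nil =>
      simp only [List.getLast?_singleton, Option.some.injEq] at hb
      subst hb
      simp only [List.mem_singleton] at hp
      subst hp
      exact ⟨le_rfl, le_rfl⟩
    | cons w L =>
      rw [List.isChain_cons_cons] at hc
      have hw : u.1 ≤ w.1 := by
        rcases hc.1 with h | h <;> rw [h] <;> simp
      rw [List.getLast?_cons_cons] at hb
      have ih' := ih w b hc.2 rfl hb
      rcases List.mem_cons.1 hp with rfl | hp
      · exact ⟨le_rfl, hw.trans (ih' w (by simp)).2⟩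
      · exact ⟨hw.trans (ih' p hp).1, (ih' p hp).2⟩

theorem ne_exists_step : ∀ (L : List (ℤ × ℤ)) (a b : ℤ × ℤ) (t : ℤ), L.IsChain neStep →
    L.head? = some a → L.getLast? = some b → a.1 ≤ t → t < b.1 → ∃ h, eastStepOf L t h := by
  intro L
  induction L with
  | nil => intro a b t _ h; simp at h
  | cons u L ih =>
    intro a b t hc ha hb h1 h2
    simp only [List.head?_cons, Option.some.injEq] at ha
    subst ha
    cases L with
    | nil =>
      simp only [List.getLast?_singleton, Option.some.injEq] at hb
      subst hb
      omega
    | cons w L =>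
      rw [List.isChain_cons_cons] at hc
      rw [List.getLast?_cons_cons] at hb
      by_cases hw : w.1 ≤ t
      · obtain ⟨h, hh⟩ := ih w b t hc.2 rfl hb hw h2
        refine ⟨h, ?_⟩
        unfold eastStepOf at hh ⊢
        simp only [List.tail_cons, List.zip_cons_cons, List.mem_cons] at hh ⊢
        exact Or.inr hh
      · obtain ⟨ux, uy⟩ := u
        rcases hc.1 with h | h
        · subst h
          simp only at h1 hw
          have : ux = t := by omega
          subst this
          exact ⟨uy, by simp [eastStepOf]⟩
        · subst h
          simp only at h1 hw
          omega

theorem east_mem {L : List (ℤ × ℤ)} {t h : ℤ} (hs : eastStepOf L t h) :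
    (t, h) ∈ L ∧ (t + 1, h) ∈ L := by
  have := List.of_mem_zip hs
  exact ⟨this.1, List.mem_of_mem_tail this.2⟩

theorem mem_interiorPts {L : List (ℤ × ℤ)} {a b p : ℤ × ℤ} (ha : L.head? = some a)
    (hb : L.getLast? = some b) (hp : p ∈ L) (hpa : p ≠ a) (hpb : p ≠ b) : p ∈ interiorPts L := by
  unfold interiorPts
  cases L with
  | nil => simp at hp
  | cons u L =>
    simp only [List.head?_cons, Option.some.injEq] at ha
    subst ha
    have hpL : p ∈ L := by
      rcases List.mem_cons.1 hp with h | h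
      · exact absurd h hpa
      · exact h
    have hne : L ≠ [] := List.ne_nil_of_mem hpL
    simp only [List.drop_succ_cons, List.drop_zero]
    rw [← List.dropLast_append_getLast hne, List.mem_append] at hpL
    rcases hpL with h | h
    · exact h
    · exfalso
      apply hpb
      rw [List.mem_singleton] at h
      rw [h]
      rw [List.getLast?_cons, Option.some.injEq] at hb
      rw [← hb, List.getLast?_eq_some_getLast hne]
      rfl

theorem frame_Q {P : Polyomino} {D : FrameData} (hP : IsFrame P D) : QProp P := by
  have hmem : ∀ x y : ℤ, (x, y) ∈ P.cells ↔
      (x, y) ∈ D.rectCells ∧ (x, y) ∉ D.holeCells := by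
    intro x y
    have := Set.ext_iff.1 hP (x, y)
    simpa using this
  have hc1 : D.S1.IsChain neStep := D.par.ne1.2
  have hc2 : D.S2.IsChain neStep := D.par.ne2.2
  have hh1 := D.head1
  have hl1 := D.last1
  have hh2 : D.S2.head? = some (D.a0, D.b0) := by rw [← D.par.headEq, hh1]
  have hl2 : D.S2.getLast? = some (D.ak, D.bk) := by rw [← D.par.lastEq, hl1]
  -- columns of hole cells
  have hcol : ∀ t h, eastStepOf D.S1 t h → D.a0 ≤ t ∧ t < D.ak := by
    intro t h hs
    have h1 := ne_bounds _ _ _ hc1 hh1 hl1 _ (east_mem hs).1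
    have h2 := ne_bounds _ _ _ hc1 hh1 hl1 _ (east_mem hs).2
    simp only at h1 h2
    omega
  -- consecutive columns overlap
  have hov : ∀ t u l, D.a0 ≤ t → t + 1 < D.ak → eastStepOf D.S1 t u →
      eastStepOf D.S2 (t + 1) l → l < u := by
    intro t u l ht1 ht2 hu hl
    refine D.par.above (t + 1, u) (mem_interiorPts hh1 hl1 (east_mem hu).2 ?_ ?_)
      (t + 1, l) (mem_interiorPts hh2 hl2 (east_mem hl).1 ?_ ?_) rfl <;>
    · simp only [ne_eq, Prod.mk.injEq, not_and]
      omega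
  -- propagation of a bound on the height
  have prop : ∀ (Y t0 : ℤ) (N : ℕ), D.a0 ≤ t0 → t0 + N < D.ak →
      (∀ h, eastStepOf D.S1 t0 h → h ≤ Y) →
      (∀ t, t0 < t → t ≤ t0 + N → (t, Y) ∈ P.cells) →
      ∀ h, eastStepOf D.S1 (t0 + N) h → h ≤ Y := by
    intro Y t0 N h0
    induction N with
    | zero => intro _ h _; simpa using h
    | succ N ih =>
      intro hN hb hfree h hs
      push_cast at hN hs hfree
      have hprev := ih (by omega) hb (fun t a b => hfree t a (by omega))
      obtain ⟨u, hu⟩ := ne_exists_step _ _ _ (t0 + N) hc1 hh1 hl1 (by simp only; omega)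
        (by simp only; omega)
      obtain ⟨l, hl⟩ := ne_exists_step _ _ _ (t0 + N + 1) hc2 hh2 hl2 (by simp only; omega)
        (by simp only; omega)
      have hlu := hov _ _ _ (by omega) (by omega) hu hl
      have huY := hprev u hu
      by_contra hcon
      have := ((hmem _ _).1 (hfree (t0 + (N + 1)) (by omega) (by omega))).2
      apply this
      rw [← add_assoc] at hs ⊢
      exact ⟨⟨h, hs, by simpa using hcon⟩, ⟨l, hl, by simp only; omega⟩⟩
  intro x1 x2 x3 y1 y2 y3 hx12 hx23 hy12 hy23 hUL hLR
  by_contra hcon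
  rw [not_or] at hcon
  obtain ⟨hLL, hUR⟩ := hcon
  unfold Inn at hLL hUR
  push Not at hLL hUR
  obtain ⟨hx, hy, a1, a2, a3, a4, ha⟩ := hLL
  obtain ⟨kx, ky, b1, b2, b3, b4, hb⟩ := hUR
  -- the four boxes are in the rectangle
  have r1 := ((hmem _ _).1 (hUL x1 (y3 - 1) le_rfl hx12 (by omega) (by omega))).1
  have r2 := ((hmem _ _).1 (hLR (x3 - 1) y1 (by omega) (by omega) le_rfl hy12)).1
  simp only [FrameData.rectCells, Set.mem_setOf_eq] at r1 r2
  rw [hmem] at ha hb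
  simp only [FrameData.rectCells, Set.mem_setOf_eq, not_and_not_right] at ha hb
  obtain ⟨⟨u, hu, hu'⟩, ⟨l, hl, hl'⟩⟩ := ha ⟨by omega, by omega, by omega, by omega⟩
  obtain ⟨⟨u2, hu2, hu2'⟩, ⟨l2, hl2', hl2''⟩⟩ := hb ⟨by omega, by omega, by omega, by omega⟩
  simp only at hu hu' hl hl' hu2 hu2' hl2' hl2''
  have ch := hcol _ _ hu
  have ck := hcol _ _ hu2
  -- left half
  have s1 : ∀ h, eastStepOf D.S1 hx h → h ≤ y2 := by
    intro h hs
    by_contra hcon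
    exact ((hmem _ _).1 (hUL hx y2 a1 a2 le_rfl hy23)).2
      ⟨⟨h, hs, by simpa using hcon⟩, ⟨l, hl, by simp only; omega⟩⟩
  have s2 := prop y2 hx (x2 - 1 - hx).toNat (by omega) (by omega) s1
    (fun t h1 h2 => hUL t y2 (by omega) (by omega) le_rfl hy23)
  rw [show hx + ((x2 - 1 - hx).toNat : ℤ) = x2 - 1 by omega] at s2
  have s3 : ∀ h, eastStepOf D.S1 x2 h → h ≤ y2 - 1 := by
    intro h hs
    by_contra hcon
    obtain ⟨u', hu'⟩ := ne_exists_step _ _ _ (x2 - 1) hc1 hh1 hl1 (by simp only; omega)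
        (by simp only; omega)
    obtain ⟨l', hl'⟩ := ne_exists_step _ _ _ (x2 - 1 + 1) hc2 hh2 hl2 (by simp only; omega)
        (by simp only; omega)
    have h1 := hov _ _ _ (by omega) (by omega) hu' hl'
    have h2 := s2 _ hu'
    rw [sub_add_cancel] at hl'
    exact ((hmem _ _).1 (hLR x2 (y2 - 1) le_rfl hx23 (by omega) (by omega))).2
      ⟨⟨h, hs, by simpa using hcon⟩, ⟨l', hl', by simp only; omega⟩⟩
  have s4 := prop (y2 - 1) x2 (kx - x2).toNat (by omega) (by omega) s3
    (fun t h1 h2 => hLR t (y2 - 1) (by omega) (by omega) (by omega) (by omega))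
  rw [show x2 + ((kx - x2).toNat : ℤ) = kx by omega] at s4
  have := s4 _ hu2
  omega

theorem frame_cell_bounds {P : Polyomino} {D : FrameData} (hP : IsFrame P D) :
    ∀ x y : ℤ, (x, y) ∈ P.cells → 1 ≤ x ∧ x + 1 ≤ D.m ∧ 1 ≤ y := by
  intro x y h
  have : (x, y) ∈ D.rectCells := by
    have h' : (x, y) ∈ (↑P.cells : Set (ℤ × ℤ)) := h
    rw [hP] at h'
    exact h'.1
  exact ⟨this.1, this.2.1, this.2.2.1⟩

theorem frame_vertex_bounds {P : Polyomino} {D : FrameData} (hP : IsFrame P D) :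
    ∀ v ∈ P.vertexSet, (0 : ℤ) ≤ v.2 := by
  rintro ⟨x, y⟩ h
  rw [mem_vertexSet_iff] at h
  simp only
  rcases h with h | h | h | h <;> have := frame_cell_bounds hP _ _ h <;> omega


/-! ### Straightening relation on monomials -/

/-- exponent vector of a single variable -/
noncomputable def sg (p : ℤ × ℤ) : ℤ × ℤ →₀ ℕ := Finsupp.single p 1

/-- one straightening step -/
def RStep (P : Polyomino) (m m' : ℤ × ℤ →₀ ℕ) : Prop :=
  ∃ (e : ℤ × ℤ →₀ ℕ) (x1 x2 y1 y2 : ℤ), x1 < x2 ∧ y1 < y2 ∧ Inn P x1 x2 y1 y2 ∧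
    m = e + sg (x1, y2) + sg (x2, y1) ∧ m' = e + sg (x1, y1) + sg (x2, y2)

/-- reflexive transitive closure of the straightening step -/
def RS (P : Polyomino) : (ℤ × ℤ →₀ ℕ) → (ℤ × ℤ →₀ ℕ) → Prop :=
  Relation.ReflTransGen (RStep P)

theorem RS.box {P : Polyomino} {m m' : ℤ × ℤ →₀ ℕ} (e : ℤ × ℤ →₀ ℕ) (x1 x2 y1 y2 : ℤ)
    (hx : x1 ≤ x2) (hy : y1 ≤ y2) (h : Inn P x1 x2 y1 y2)
    (hm : m = e + sg (x1, y2) + sg (x2, y1)) (hm' : m' = e + sg (x1, y1) + sg (x2, y2)) :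
    RS P m m' := by
  rcases hx.eq_or_lt with rfl | hx
  · have : m = m' := by rw [hm, hm']; abel
    rw [this]; exact Relation.ReflTransGen.refl
  rcases hy.eq_or_lt with rfl | hy
  · have : m = m' := by rw [hm, hm']
    rw [this]; exact Relation.ReflTransGen.refl
  exact Relation.ReflTransGen.single ⟨e, x1, x2, y1, y2, hx, hy, h, hm, hm'⟩

theorem sg_cancel {e e' : ℤ × ℤ →₀ ℕ} {d d' : ℤ × ℤ} (h : e + sg d = e' + sg d') (hd : d ≠ d') :
    ∃ f, e = f + sg d' ∧ e' = f + sg d := by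
  have h1 : sg d' ≤ e := by
    rw [sg, Finsupp.single_le_iff]
    have := DFunLike.congr_fun h d'
    simp [sg, Finsupp.single_apply, hd] at this
    omega
  obtain ⟨f, rfl⟩ := exists_add_of_le h1
  refine ⟨f, add_comm _ _, ?_⟩
  have : (f + sg d) + sg d' = e' + sg d' := by rw [← h]; abel
  exact (add_right_cancel this).symm

/-- two monomials have a common reduct -/
def Joins (P : Polyomino) (p q : ℤ × ℤ →₀ ℕ) : Prop := ∃ z, RS P p z ∧ RS P q z

theorem Joins.symm {P : Polyomino} {p q : ℤ × ℤ →₀ ℕ} (h : Joins P p q) : Joins P q p := by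
  obtain ⟨z, h1, h2⟩ := h
  exact ⟨z, h2, h1⟩

theorem join_UL {P : Polyomino} (f : ℤ × ℤ →₀ ℕ) {x y p q p' q' : ℤ} (hp : x < p) (hq : q < y)
    (hp' : x < p') (hq' : q' < y) (h : Inn P x p q y) (h' : Inn P x p' q' y) (hpp : p ≤ p') :
    Joins P (f + sg (p', q') + sg (x, q) + sg (p, y))
      (f + sg (p, q) + sg (x, q') + sg (p', y)) := by
  have s1 : RS P (f + sg (p', q') + sg (x, q) + sg (p, y))
      (f + sg (x, q) + sg (p, q') + sg (p', y)) :=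
    RS.box (f + sg (x, q)) p p' q' y hpp hq'.le
      (h'.mono (by omega) le_rfl le_rfl le_rfl) (by abel) (by abel)
  rcases le_total q q' with hqq | hqq
  · exact ⟨_, s1, RS.box (f + sg (p', y)) x p q q' hp.le hqq
      (h.mono le_rfl le_rfl le_rfl (by omega)) (by abel) (by abel)⟩
  · refine ⟨_, s1.trans ?_, Relation.ReflTransGen.refl⟩
    exact RS.box (f + sg (p', y)) x p q' q hp.le hqq
      (h'.mono le_rfl (by omega) le_rfl (by omega)) (by abel) (by abel)

theorem join_LR {P : Polyomino} (f : ℤ × ℤ →₀ ℕ) {x y p q p' q' : ℤ} (hp : p < x) (hq : y < q)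
    (hp' : p' < x) (hq' : y < q') (h : Inn P p x y q) (h' : Inn P p' x y q') (hqq : q ≤ q') :
    Joins P (f + sg (p', q') + sg (p, y) + sg (x, q))
      (f + sg (p, q) + sg (p', y) + sg (x, q')) := by
  have s1 : RS P (f + sg (p', q') + sg (p, y) + sg (x, q))
      (f + sg (p, y) + sg (p', q) + sg (x, q')) :=
    RS.box (f + sg (p, y)) p' x q q' hp'.le hqq
      (h'.mono le_rfl le_rfl hq.le le_rfl) (by abel) (by abel)
  rcases le_total p p' with hpp | hpp
  · exact ⟨_, s1, RS.box (f + sg (x, q')) p p' y q hpp hq.le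
      (h.mono le_rfl (by omega) le_rfl le_rfl) (by abel) (by abel)⟩
  · refine ⟨_, s1.trans ?_, Relation.ReflTransGen.refl⟩
    exact RS.box (f + sg (x, q')) p' p y q hpp hq.le
      (h'.mono le_rfl (by omega) le_rfl (by omega)) (by abel) (by abel)

theorem join_mid {P : Polyomino} (Q : QProp P) (f : ℤ × ℤ →₀ ℕ) {x1 x2 x3 y1 y2 y3 : ℤ}
    (hx : x1 < x2) (hx' : x2 < x3) (hy : y1 < y2) (hy' : y2 < y3)
    (h1 : Inn P x1 x2 y2 y3) (h2 : Inn P x2 x3 y1 y2) :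
    Joins P (f + sg (x1, y3) + sg (x2, y1) + sg (x3, y2))
      (f + sg (x3, y1) + sg (x1, y2) + sg (x2, y3)) := by
  rcases Q _ _ _ _ _ _ hx hx' hy hy' h1 h2 with h | h
  · refine ⟨f + sg (x1, y1) + sg (x2, y3) + sg (x3, y2),
      RS.box (f + sg (x3, y2)) x1 x2 y1 y3 hx.le (by omega) (h.vj h1) (by abel) (by abel),
      RS.box (f + sg (x2, y3)) x1 x3 y1 y2 (by omega) hy.le (h.hj h2) (by abel) (by abel)⟩
  · refine ⟨f + sg (x2, y1) + sg (x1, y2) + sg (x3, y3),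
      RS.box (f + sg (x2, y1)) x1 x3 y2 y3 (by omega) hy'.le (h1.hj h) (by abel) (by abel),
      RS.box (f + sg (x1, y2)) x2 x3 y1 y3 hx'.le (by omega) (h2.vj h) (by abel) (by abel)⟩

theorem local_confluent {P : Polyomino} (Q : QProp P) {m p q : ℤ × ℤ →₀ ℕ}
    (hp : RStep P m p) (hq : RStep P m q) : Joins P p q := by
  obtain ⟨e, x1, x2, y1, y2, hx, hy, hI, hm, rfl⟩ := hp
  obtain ⟨e', u1, u2, v1, v2, hu, hv, hI', hm', rfl⟩ := hq
  rw [hm] at hm'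
  by_cases hc : ((x1, y2) : ℤ × ℤ) = (u1, v2)
  · obtain ⟨rfl, rfl⟩ := Prod.mk.inj hc
    have h1 : e + sg (x2, y1) = e' + sg (u2, v1) := by
      apply add_right_cancel (b := sg (x1, y2))
      calc _ = e + sg (x1, y2) + sg (x2, y1) := by abel
        _ = _ := hm'
        _ = _ := by abel
    by_cases hd : ((x2, y1) : ℤ × ℤ) = (u2, v1)
    · obtain ⟨rfl, rfl⟩ := Prod.mk.inj hd
      rw [add_right_cancel h1]
      exact ⟨_, Relation.ReflTransGen.refl, Relation.ReflTransGen.refl⟩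
    · obtain ⟨f, rfl, rfl⟩ := sg_cancel h1 hd
      rcases le_total x2 u2 with h | h
      · exact join_UL f hx hy hu hv hI hI' h
      · exact (join_UL f hu hv hx hy hI' hI h).symm
  by_cases hd : ((x2, y1) : ℤ × ℤ) = (u2, v1)
  · obtain ⟨rfl, rfl⟩ := Prod.mk.inj hd
    obtain ⟨f, rfl, rfl⟩ := sg_cancel (add_right_cancel hm') hc
    rcases le_total y2 v2 with h | h
    · exact join_LR f hx hy hu hv hI hI' h
    · exact (join_LR f hu hv hx hy hI' hI h).symm
  by_cases h1 : ((x1, y2) : ℤ × ℤ) = (u2, v1)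
  · obtain ⟨rfl, rfl⟩ := Prod.mk.inj h1
    have h1 : e + sg (x2, y1) = e' + sg (u1, v2) := by
      apply add_right_cancel (b := sg (x1, y2))
      calc _ = e + sg (x1, y2) + sg (x2, y1) := by abel
        _ = _ := hm'
    obtain ⟨f, rfl, rfl⟩ := sg_cancel h1 (by rw [Ne, Prod.mk.injEq]; omega)
    exact join_mid Q f hu hx hy hv hI' hI
  by_cases h2 : ((x2, y1) : ℤ × ℤ) = (u1, v2)
  · obtain ⟨rfl, rfl⟩ := Prod.mk.inj h2
    have h1 : e + sg (x1, y2) = e' + sg (u2, v1) := by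
      apply add_right_cancel (b := sg (x2, y1))
      calc _ = _ := hm'
        _ = _ := by abel
    obtain ⟨f, rfl, rfl⟩ := sg_cancel h1 (by rw [Ne, Prod.mk.injEq]; omega)
    exact (join_mid Q f hx hu hv hy hI hI').symm
  have hm2 : e + sg (x2, y1) + sg (x1, y2) = e' + sg (u2, v1) + sg (u1, v2) := by
    calc _ = e + sg (x1, y2) + sg (x2, y1) := by abel
      _ = _ := hm'
      _ = _ := by abel
  obtain ⟨g, hg, hg'⟩ := sg_cancel hm2 hc
  obtain ⟨k, rfl, rfl⟩ := sg_cancel hg h2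
  obtain ⟨k', rfl, hk'⟩ := sg_cancel hg' (Ne.symm h1)
  obtain ⟨f, rfl, rfl⟩ := sg_cancel hk' hd
  refine ⟨f + sg (x1, y1) + sg (x2, y2) + sg (u1, v1) + sg (u2, v2),
    RS.box (f + sg (x1, y1) + sg (x2, y2)) u1 u2 v1 v2 hu.le hv.le hI' (by abel) (by abel),
    RS.box (f + sg (u1, v1) + sg (u2, v2)) x1 x2 y1 y2 hx.le hy.le hI (by abel) (by abel)⟩

theorem newman {α : Type} (r : α → α → Prop) (μ : α → ℕ) (hμ : ∀ a b, r a b → μ b < μ a)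
    (lc : ∀ a b c, r a b → r a c →
      ∃ z, Relation.ReflTransGen r b z ∧ Relation.ReflTransGen r c z) :
    ∀ (n : ℕ) (a b c : α), μ a = n → Relation.ReflTransGen r a b → Relation.ReflTransGen r a c →
      ∃ z, Relation.ReflTransGen r b z ∧ Relation.ReflTransGen r c z := by
  intro n
  induction n using Nat.strong_induction_on with
  | _ n ih =>
    intro a b c hn hb hc
    rcases Relation.ReflTransGen.cases_head hb with rfl | ⟨b', hab, hb'⟩
    · exact ⟨c, hc, Relation.ReflTransGen.refl⟩
    rcases Relation.ReflTransGen.cases_head hc with rfl | ⟨c', hac, hc'⟩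
    · exact ⟨b, Relation.ReflTransGen.refl, hb⟩
    obtain ⟨w, hw1, hw2⟩ := lc _ _ _ hab hac
    obtain ⟨u, hu1, hu2⟩ := ih _ (hn ▸ hμ _ _ hab) b' b w rfl hb' hw1
    obtain ⟨z, hz1, hz2⟩ := ih _ (hn ▸ hμ _ _ hac) c' u c rfl (hw2.trans hu2) hc'
    exact ⟨z, hu1.trans hz1, hz2⟩

/-- termination weight -/
noncomputable def wtM (M : ℤ) (m : ℤ × ℤ →₀ ℕ) : ℕ :=
  Finsupp.weight (fun p : ℤ × ℤ => ((M - p.1) * p.2).toNat) m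

theorem wtM_add (M : ℤ) (m m' : ℤ × ℤ →₀ ℕ) : wtM M (m + m') = wtM M m + wtM M m' := by
  simp [wtM]

theorem wtM_sg (M : ℤ) (p : ℤ × ℤ) : wtM M (sg p) = ((M - p.1) * p.2).toNat := by
  simp [wtM, sg, Finsupp.weight_apply]

theorem RStep.wt_lt {P : Polyomino} {M : ℤ}
    (hb : ∀ x y, (x, y) ∈ P.cells → 1 ≤ x ∧ x + 1 ≤ M ∧ 1 ≤ y)
    {m m' : ℤ × ℤ →₀ ℕ} (h : RStep P m m') : wtM M m' < wtM M m := by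
  obtain ⟨e, x1, x2, y1, y2, hx, hy, hI, rfl, rfl⟩ := h
  have b1 := hb _ _ (hI x1 y1 le_rfl hx le_rfl hy)
  have b2 := hb _ _ (hI (x2 - 1) y1 (by omega) (by omega) le_rfl hy)
  simp only [wtM_add, wtM_sg]
  have h0 : ∀ x y : ℤ, x ≤ x2 → y1 ≤ y → (((M - x) * y).toNat : ℤ) = (M - x) * y := by
    intro x y hx hy
    exact Int.toNat_of_nonneg (mul_nonneg (by omega) (by omega))
  zify
  rw [h0 _ _ hx.le le_rfl, h0 _ _ le_rfl hy.le, h0 _ _ hx.le hy.le, h0 _ _ le_rfl le_rfl]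
  nlinarith [mul_pos (sub_pos.2 hx) (sub_pos.2 hy)]

theorem RS.invariant {P : Polyomino} (Q : QProp P) {M : ℤ}
    (hb : ∀ x y, (x, y) ∈ P.cells → 1 ≤ x ∧ x + 1 ≤ M ∧ 1 ≤ y)
    {m m' z : ℤ × ℤ →₀ ℕ} (h : RStep P m m') (hz : ∀ w, ¬ RStep P z w) :
    RS P m z ↔ RS P m' z := by
  constructor
  · intro h1
    obtain ⟨w, hw1, hw2⟩ := newman (RStep P) (wtM M) (fun _ _ h => h.wt_lt hb)
      (fun _ _ _ h1 h2 => local_confluent Q h1 h2) _ m z m' rfl h1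
      (Relation.ReflTransGen.single h)
    rcases Relation.ReflTransGen.cases_head hw1 with rfl | ⟨c, hc, _⟩
    · exact hw2
    · exact absurd hc (hz _)
  · intro h1
    exact Relation.ReflTransGen.head h h1


/-! ### The initial ideal -/

theorem revlexLT_irrefl' (a : ℤ × ℤ →₀ ℕ) : ¬ revlexLT varlt a a := by
  rintro (h | ⟨_, v, h, _⟩) <;> exact lt_irrefl _ h

theorem revlexLT_trans' {a b c : ℤ × ℤ →₀ ℕ} (h1 : revlexLT varlt a b) (h2 : revlexLT varlt b c) :
    revlexLT varlt a c := by
  rcases h1 with h1 | ⟨h1, v, hv, hv'⟩ <;> rcases h2 with h2 | ⟨h2, w, hw, hw'⟩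
  · exact Or.inl (h1.trans h2)
  · exact Or.inl (h2 ▸ h1)
  · exact Or.inl (h1 ▸ h2)
  · refine Or.inr ⟨h1.trans h2, ?_⟩
    rcases varlt_total v w with h | rfl | h
    · refine ⟨v, by rw [← hw' v h]; exact hv, fun u hu => ?_⟩
      rw [hv' u hu, hw' u (varlt_trans hu h)]
    · exact ⟨v, hw.trans hv, fun u hu => by rw [hv' u hu, hw' u hu]⟩
    · refine ⟨w, by rw [hv' w h]; exact hw, fun u hu => ?_⟩
      rw [hv' u (varlt_trans hu h), hw' u hu]

theorem sum_add' {α : Type} (a b : α →₀ ℕ) : ((a + b).sum fun _ e => e) =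
    (a.sum fun _ e => e) + (b.sum fun _ e => e) := by
  classical
  exact Finsupp.sum_add_index' (fun _ => rfl) (fun _ _ _ => rfl)

theorem RStep.revlex {P : Polyomino} {m m' : ℤ × ℤ →₀ ℕ} (h : RStep P m m') :
    revlexLT varlt m' m := by
  obtain ⟨e, x1, x2, y1, y2, hx, hy, hI, rfl, rfl⟩ := h
  right
  refine ⟨by simp [sum_add', sg], (x1, y1), ?_, ?_⟩
  · have h1 : (x1, y2) ≠ (x1, y1) := by rw [Ne, Prod.mk.injEq]; omega
    have h2 : (x2, y1) ≠ (x1, y1) := by rw [Ne, Prod.mk.injEq]; omega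
    have h3 : (x2, y2) ≠ (x1, y1) := by rw [Ne, Prod.mk.injEq]; omega
    simp only [sg, Finsupp.add_apply, Finsupp.single_apply, h1, h2, h3, if_true, if_false]
    omega
  · rintro ⟨u, v⟩ hu
    simp only [varlt] at hu
    have h0 : (x1, y1) ≠ (u, v) := by rw [Ne, Prod.mk.injEq]; omega
    have h1 : (x1, y2) ≠ (u, v) := by rw [Ne, Prod.mk.injEq]; omega
    have h2 : (x2, y1) ≠ (u, v) := by rw [Ne, Prod.mk.injEq]; omega
    have h3 : (x2, y2) ≠ (u, v) := by rw [Ne, Prod.mk.injEq]; omega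
    simp only [sg, Finsupp.add_apply, Finsupp.single_apply, h0, h1, h2, h3, if_false]

theorem RS.revlex {P : Polyomino} {m m' : ℤ × ℤ →₀ ℕ} (h : RS P m m') :
    m = m' ∨ revlexLT varlt m' m := by
  induction h with
  | refl => exact Or.inl rfl
  | tail _ h ih =>
    rcases ih with rfl | ih
    · exact Or.inr h.revlex
    · exact Or.inr (revlexLT_trans' h.revlex ih)

/-- forget that the variables are vertices of `P` -/
noncomputable def forgetV (P : Polyomino) (m : PVertex P →₀ ℕ) : ℤ × ℤ →₀ ℕ :=
  m.mapDomain Subtype.val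

theorem forgetV_apply {P : Polyomino} (m : PVertex P →₀ ℕ) (v : PVertex P) : forgetV P m v.1 = m v :=
  Finsupp.mapDomain_apply Subtype.val_injective _ _

theorem forgetV_notMem {P : Polyomino} (m : PVertex P →₀ ℕ) (v : ℤ × ℤ) (hv : v ∉ P.vertexSet) :
    forgetV P m v = 0 :=
  Finsupp.mapDomain_of_notMem_range _ _ (by rintro ⟨w, rfl⟩; exact hv w.2)

theorem forgetV_inj {P : Polyomino} {m m' : PVertex P →₀ ℕ} (h : forgetV P m = forgetV P m') : m = m' :=
  Finsupp.mapDomain_injective Subtype.val_injective h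

theorem forgetV_add {P : Polyomino} (m m' : PVertex P →₀ ℕ) : forgetV P (m + m') = forgetV P m + forgetV P m' :=
  Finsupp.mapDomain_add

theorem forgetV_single {P : Polyomino} (v : PVertex P) : forgetV P (Finsupp.single v 1) = sg v.1 :=
  Finsupp.mapDomain_single

theorem forgetV_sum {P : Polyomino} (m : PVertex P →₀ ℕ) :
    ((forgetV P m).sum fun _ e => e) = m.sum fun _ e => e := by
  classical
  exact Finsupp.sum_mapDomain_index (fun _ => rfl) (fun _ _ _ => rfl)

theorem pmonLT_forgetV {P : Polyomino} {m m' : PVertex P →₀ ℕ} (h : pmonLT P m m') :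
    revlexLT varlt (forgetV P m) (forgetV P m') := by
  rcases h with h | ⟨h, v, hv, hw⟩
  · left; rw [forgetV_sum, forgetV_sum]; exact h
  · right
    refine ⟨by rw [forgetV_sum, forgetV_sum]; exact h, v.1, by rw [forgetV_apply, forgetV_apply]; exact hv, ?_⟩
    intro w hwv
    by_cases hwP : w ∈ P.vertexSet
    · have := hw ⟨w, hwP⟩ hwv
      rw [← forgetV_apply, ← forgetV_apply] at this
      exact this
    · rw [forgetV_notMem _ _ hwP, forgetV_notMem _ _ hwP]

theorem pmonLT_of_forgetV {P : Polyomino} {m m' : PVertex P →₀ ℕ}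
    (h : revlexLT varlt (forgetV P m) (forgetV P m')) : pmonLT P m m' := by
  rcases h with h | ⟨h, v, hv, hw⟩
  · left; rw [forgetV_sum, forgetV_sum] at h; exact h
  · right
    rw [forgetV_sum, forgetV_sum] at h
    by_cases hvP : v ∈ P.vertexSet
    · refine ⟨h, ⟨v, hvP⟩, ?_, ?_⟩
      · rw [← forgetV_apply, ← forgetV_apply]; exact hv
      · intro w hwv
        rw [← forgetV_apply, ← forgetV_apply]; exact hw _ hwv
    · rw [forgetV_notMem _ _ hvP, forgetV_notMem _ _ hvP] at hv
      exact absurd hv (lt_irrefl _)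

open Classical in
/-- the linear functional reading off the coefficient of the normal form `z` -/
noncomputable def phi (K : Type) [Field K] (P : Polyomino) (z : ℤ × ℤ →₀ ℕ) :
    PolyRing K P →ₗ[K] K :=
  (MvPolynomial.basisMonomials (PVertex P) K).constr K
    (fun m => if RS P (forgetV P m) z then (1 : K) else 0)

open Classical in
theorem phi_monomial (K : Type) [Field K] (P : Polyomino) (z : ℤ × ℤ →₀ ℕ) (m : PVertex P →₀ ℕ)
    (a : K) : phi K P z (MvPolynomial.monomial m a) = if RS P (forgetV P m) z then a else 0 := by
  have h : MvPolynomial.monomial m a = a • (MvPolynomial.basisMonomials (PVertex P) K) m := by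
    rw [MvPolynomial.coe_basisMonomials, MvPolynomial.smul_monomial]; simp
  rw [h, map_smul, phi, Module.Basis.constr_basis]
  split_ifs <;> simp

theorem isInner_iff {P : Polyomino} {a b : ℤ × ℤ} : IsInnerInterval P a b ↔
    a.1 < b.1 ∧ a.2 < b.2 ∧ Inn P a.1 b.1 a.2 b.2 := by
  unfold IsInnerInterval cellInInterval Inn
  constructor
  · rintro ⟨h1, h2, h⟩
    exact ⟨h1, h2, fun x y a1 a2 a3 a4 => h (x, y) ⟨a1, by omega, a3, by omega⟩⟩
  · rintro ⟨h1, h2, h⟩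
    exact ⟨h1, h2, fun c hc => h c.1 c.2 hc.1 (by omega) hc.2.2.1 (by omega)⟩

theorem XX_eq {σ K : Type} [Field K] (a b : σ) :
    (MvPolynomial.X a * MvPolynomial.X b : MvPolynomial σ K) =
      MvPolynomial.monomial (Finsupp.single a 1 + Finsupp.single b 1) 1 := by
  rw [MvPolynomial.X, MvPolynomial.X, MvPolynomial.monomial_mul, one_mul]

theorem phi_vanish (K : Type) [Field K] {P : Polyomino} (Q : QProp P) {M : ℤ}
    (hb : ∀ x y, (x, y) ∈ P.cells → 1 ≤ x ∧ x + 1 ≤ M ∧ 1 ≤ y) {z : ℤ × ℤ →₀ ℕ}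
    (hz : ∀ w, ¬ RStep P z w) {f : PolyRing K P} (hf : f ∈ polyIdeal K P) : phi K P z f = 0 := by
  classical
  have key : ∀ g : PolyRing K P, phi K P z (g * f) = 0 := by
    unfold polyIdeal Ideal.span at hf
    induction hf using Submodule.span_induction with
    | mem f hf =>
      obtain ⟨a, b, c, d, hI, hc, hd, rfl⟩ := hf
      rw [isInner_iff] at hI
      intro g
      induction g using MvPolynomial.induction_on' with
      | monomial u t =>
        rw [XX_eq, XX_eq, mul_sub, MvPolynomial.monomial_mul, MvPolynomial.monomial_mul, map_sub,
          phi_monomial, phi_monomial]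
        have hR : RStep P (forgetV P (u + (Finsupp.single c 1 + Finsupp.single d 1)))
            (forgetV P (u + (Finsupp.single a 1 + Finsupp.single b 1))) := by
          refine ⟨forgetV P u, a.1.1, b.1.1, a.1.2, b.1.2, hI.1, hI.2.1, hI.2.2, ?_, ?_⟩
          · simp only [forgetV_add, forgetV_single, hc, hd]; abel
          · simp only [forgetV_add, forgetV_single]; abel
        have := RS.invariant Q hb hR hz
        simp only [this, sub_self]
      | add p q hp hq => rw [add_mul, map_add, hp, hq, add_zero]
    | zero => intro g; rw [mul_zero, map_zero]
    | add x y _ _ hx hy => intro g; rw [mul_add, map_add, hx, hy, add_zero]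
    | smul a x _ hx =>
      intro g
      rw [smul_eq_mul, ← mul_assoc]
      exact hx _
  have := key 1
  rwa [one_mul] at this

theorem lead_reducible (K : Type) [Field K] {P : Polyomino} (Q : QProp P) {M : ℤ}
    (hb : ∀ x y, (x, y) ∈ P.cells → 1 ≤ x ∧ x + 1 ≤ M ∧ 1 ≤ y) {f : PolyRing K P}
    (hf : f ∈ polyIdeal K P) {m : PVertex P →₀ ℕ} (hm : IsLeadMon (pmonLT P) f m) :
    ∃ w, RStep P (forgetV P m) w := by
  classical
  by_contra hcon
  push Not at hcon
  have h0 := phi_vanish K Q hb hcon hf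
  rw [← MvPolynomial.support_sum_monomial_coeff f, map_sum, Finset.sum_eq_single m] at h0
  · rw [phi_monomial, if_pos (show RS P _ _ from Relation.ReflTransGen.refl)] at h0
    exact MvPolynomial.mem_support_iff.1 hm.1 h0
  · intro m' hm' hne
    rw [phi_monomial, if_neg]
    intro hR
    rcases hR.revlex with h | h
    · exact hne (forgetV_inj h)
    · exact revlexLT_irrefl' _ (revlexLT_trans' h (pmonLT_forgetV (hm.2 m' hm' hne)))
  · intro h
    exact absurd hm.1 h

theorem expOf_apply (P : Polyomino) (W : Finset (ℤ × ℤ)) (v : PVertex P) :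
    expOf P W v = if v.1 ∈ W then 1 else 0 := by
  unfold expOf
  rw [Finsupp.finsetSum_apply, Finset.sum_eq_single v]
  · split_ifs <;> simp
  · intro b _ hb
    split_ifs
    · exact Finsupp.single_eq_of_ne hb.symm
    · rfl
  · intro h
    exact absurd (Finset.mem_attach _ _) h

theorem minor_lead (K : Type) [Field K] {P : Polyomino} {a b c d : PVertex P}
    (hI : IsInnerInterval P a.1 b.1) (hc : c.1 = (a.1.1, b.1.2)) (hd : d.1 = (b.1.1, a.1.2)) :
    IsLeadMon (pmonLT P) (MvPolynomial.X a * MvPolynomial.X b -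
      MvPolynomial.X c * MvPolynomial.X d : PolyRing K P)
      (Finsupp.single c 1 + Finsupp.single d 1) := by
  classical
  rw [isInner_iff] at hI
  have hR : RStep P (forgetV P (Finsupp.single c 1 + Finsupp.single d 1))
      (forgetV P (Finsupp.single a 1 + Finsupp.single b 1)) := by
    refine ⟨0, a.1.1, b.1.1, a.1.2, b.1.2, hI.1, hI.2.1, hI.2.2, ?_, ?_⟩
    · simp only [forgetV_add, forgetV_single, hc, hd]; abel
    · simp only [forgetV_add, forgetV_single]; abel
  have hlt := pmonLT_of_forgetV hR.revlex
  have hne : (Finsupp.single a 1 + Finsupp.single b 1 : PVertex P →₀ ℕ) ≠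
      Finsupp.single c 1 + Finsupp.single d 1 := by
    intro h
    have := hR.revlex
    rw [h] at this
    exact revlexLT_irrefl' _ this
  rw [XX_eq, XX_eq]
  constructor
  · rw [MvPolynomial.mem_support_iff, MvPolynomial.coeff_sub, MvPolynomial.coeff_monomial,
      MvPolynomial.coeff_monomial, if_neg hne, if_pos rfl]
    simp
  · intro m' hm' hne'
    rw [MvPolynomial.mem_support_iff, MvPolynomial.coeff_sub, MvPolynomial.coeff_monomial,
      MvPolynomial.coeff_monomial, if_neg (Ne.symm hne'), sub_zero] at hm'
    have : (Finsupp.single a 1 + Finsupp.single b 1 : PVertex P →₀ ℕ) = m' := by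
      by_contra h
      exact hm' (if_neg h)
    rw [← this]
    exact hlt

theorem mem_inIdeal_iff (K : Type) [Field K] {P : Polyomino} (m : PVertex P →₀ ℕ) :
    MvPolynomial.monomial m (1 : K) ∈ inIdeal K P ↔
      ∃ f ∈ polyIdeal K P, ∃ u, IsLeadMon (pmonLT P) f u ∧ u ≤ m := by
  classical
  have hset : { g : PolyRing K P | ∃ f ∈ polyIdeal K P, f ≠ 0 ∧ ∃ m, IsLeadMon (pmonLT P) f m ∧
      g = MvPolynomial.monomial m 1 } = (fun s => MvPolynomial.monomial s (1 : K)) ''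
        { u | ∃ f ∈ polyIdeal K P, IsLeadMon (pmonLT P) f u } := by
    ext g
    constructor
    · rintro ⟨f, hf, _, u, hu, rfl⟩
      exact ⟨u, ⟨f, hf, hu⟩, rfl⟩
    · rintro ⟨u, ⟨f, hf, hu⟩, rfl⟩
      refine ⟨f, hf, ?_, u, hu, rfl⟩
      rintro rfl
      simpa using hu.1
  unfold inIdeal initialIdeal
  rw [hset, MvPolynomial.mem_ideal_span_monomial_image]
  have hs : (MvPolynomial.monomial m (1 : K)).support = {m} := by
    rw [MvPolynomial.support_monomial, if_neg one_ne_zero]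
  rw [hs]
  constructor
  · intro h
    obtain ⟨u, ⟨f, hf, hu⟩, hle⟩ := h m (Finset.mem_singleton_self _)
    exact ⟨f, hf, u, hu, hle⟩
  · rintro ⟨f, hf, u, hu, hle⟩ x hx
    rw [Finset.mem_singleton] at hx
    exact ⟨u, ⟨f, hf, hu⟩, hx ▸ hle⟩

theorem isFace_iff (K : Type) [Field K] {P : Polyomino} (Q : QProp P) {M : ℤ}
    (hb : ∀ x y, (x, y) ∈ P.cells → 1 ≤ x ∧ x + 1 ≤ M ∧ 1 ≤ y) (W : Finset (ℤ × ℤ)) :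
    IsFace K P W ↔ CFace P W := by
  unfold IsFace CFace
  rw [Finset.coe_subset]
  refine and_congr_right fun hW => ?_
  rw [mem_inIdeal_iff]
  constructor
  · intro h c hc d hd hcf
    obtain ⟨h1, h2, h3⟩ := hcf
    apply h
    have hI : IsInnerInterval P (c.1, d.2) (d.1, c.2) := isInner_iff.2 ⟨h1, h2, h3⟩
    refine ⟨_, Ideal.subset_span ⟨⟨(c.1, d.2), h3.mem h1 h2 le_rfl h1.le le_rfl h2.le⟩,
      ⟨(d.1, c.2), h3.mem h1 h2 h1.le le_rfl h2.le le_rfl⟩, ⟨c, hW hc⟩, ⟨d, hW hd⟩,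
      hI, rfl, rfl, rfl⟩, _, minor_lead K hI rfl rfl, ?_⟩
    have hne : c ≠ d := fun h => by rw [h] at h1; exact lt_irrefl _ h1
    intro v
    rw [expOf_apply, Finsupp.add_apply, Finsupp.single_apply, Finsupp.single_apply]
    by_cases hvc : (⟨c, hW hc⟩ : PVertex P) = v
    · subst hvc
      simp [hc, hne.symm]
    · by_cases hvd : (⟨d, hW hd⟩ : PVertex P) = v
      · subst hvd
        simp [hd, hne]
      · simp [hvc, hvd]
  · rintro h ⟨f, hf, u, hu, hle⟩
    obtain ⟨w, e, x1, x2, y1, y2, hx, hy, hI, hm, _⟩ := lead_reducible K Q hb hf hu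
    have hmem : ∀ p : ℤ × ℤ, p ∈ P.vertexSet → 0 < forgetV P u p → p ∈ W := by
      intro p hp hpos
      rw [show forgetV P u p = u ⟨p, hp⟩ from forgetV_apply u ⟨p, hp⟩] at hpos
      have h1 := hle ⟨p, hp⟩
      rw [expOf_apply] at h1
      by_contra hpW
      rw [if_neg hpW] at h1
      omega
    refine h (x1, y2) (hmem _ (hI.mem hx hy le_rfl hx.le hy.le le_rfl) ?_)
      (x2, y1) (hmem _ (hI.mem hx hy hx.le le_rfl le_rfl hy.le) ?_) ⟨hx, hy, hI⟩
    · rw [hm]; simp [sg]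
    · rw [hm]; simp [sg]

theorem isFacet_iff (K : Type) [Field K] {P : Polyomino} (Q : QProp P) {M : ℤ}
    (hb : ∀ x y, (x, y) ∈ P.cells → 1 ≤ x ∧ x + 1 ≤ M ∧ 1 ≤ y) (W : Finset (ℤ × ℤ)) :
    IsFacet K P W ↔ CFacet P W := by
  unfold IsFacet CFacet
  simp only [isFace_iff K Q hb]

theorem frame_shellable (K : Type) [Field K] (P : Polyomino)
    (D : FrameData) (hP : IsFrame P D) :
    (∀ F G : Finset (ℤ × ℤ), IsFacet K P F → IsFacet K P G → F.card = G.card) ∧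
    (∀ F : Finset (ℤ × ℤ), IsFacet K P F → (∃ G, IsFacet K P G ∧ flexLT F G) →
      ∃ M : Set (Finset (ℤ × ℤ)), M.Nonempty ∧ (∀ W ∈ M, ∃ v ∈ F, W = F.erase v) ∧
        genComplex { G | IsFacet K P G ∧ flexLT F G } ∩ genComplex {F} = genComplex M) := by
  have Q := frame_Q hP
  have hb := frame_cell_bounds hP
  simp only [isFacet_iff K Q hb]
  exact ⟨fun F G hF hG => pure_aux Q (frame_vertex_bounds hP) _ F G hF hG rfl,
    fun F hF hex => shelling_aux Q F hF hex⟩
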